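/- arXiv:2401.03161 — 4 statements merged into one kernel-verified Lean document; each statement's English description precedes it below -/
import Mathlib

section
/- Theorem 2.1 (mass conservation). Let (n, n₊, n₋) be a classical solution of the CRTM on [0,∞). Then the total mass M(t) = ∫_{−L}^{L}∫_{−π}^{π} n(t,y,θ) dθ dy + ∫_0^{π} n₊(t,θ) dθ + ∫_{−π}^{0} n₋(t,θ) dθ is constant in time: M(t) = M(0) for all t ≥ 0. -/
open MeasureTheory Real Set

noncomputable section

/-- A classical solution of the confined run-and-tumble model (CRTM) on `[0,∞)`:
a triple of `C¹` functions `n : [0,∞)×[−L,L]×[−π,π] → ℝ`, `np : [0,∞)×[0,π] → ℝ`,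
`nm : [0,∞)×[−π,0] → ℝ` satisfying the interior kinetic equation (i), the boundary
evolution equations (ii), (iii), the periodicity condition (iv) and the inflow boundary
conditions (v), (vi).  The total tumbling rates `k(y,θ) = ∫_{−π}^{π} K(y,θ,θ'−θ) dθ'`,
`k₊(θ) = ∫_{−π}^{π} K₊(θ,θ'−θ) dθ'`, `k₋(θ) = ∫_{−π}^{π} K₋(θ,θ'−θ) dθ'` are inlined. -/
structure IsCRTMSolution (V L : ℝ)
    (K : ℝ → ℝ → ℝ → ℝ) (Kp : ℝ → ℝ → ℝ) (Km : ℝ → ℝ → ℝ)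
    (n : ℝ → ℝ → ℝ → ℝ) (np : ℝ → ℝ → ℝ) (nm : ℝ → ℝ → ℝ) : Prop where
  smooth_n : ContDiff ℝ 1 (fun p : ℝ × ℝ × ℝ => n p.1 p.2.1 p.2.2)
  smooth_np : ContDiff ℝ 1 (fun p : ℝ × ℝ => np p.1 p.2)
  smooth_nm : ContDiff ℝ 1 (fun p : ℝ × ℝ => nm p.1 p.2)
  interior_eq : ∀ t ≥ (0:ℝ), ∀ y ∈ Ioo (-L) L, ∀ θ ∈ Ioo (-π) π,
    deriv (fun s => n s y θ) t + V * sin θ * deriv (fun z => n t z θ) y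
      + (∫ θ' in (-π)..π, K y θ (θ' - θ)) * n t y θ
      = ∫ θ' in (-π)..π, K y θ' (θ - θ') * n t y θ'
  top_eq : ∀ t ≥ (0:ℝ), ∀ θ ∈ Ioo (0:ℝ) π,
    deriv (fun s => np s θ) t + (∫ θ' in (-π)..π, Kp θ (θ' - θ)) * np t θ
      = (∫ θ' in (0:ℝ)..π, Kp θ' (θ - θ') * np t θ') + V * sin θ * n t L θ
  bot_eq : ∀ t ≥ (0:ℝ), ∀ θ ∈ Ioo (-π) (0:ℝ),
    deriv (fun s => nm s θ) t + (∫ θ' in (-π)..π, Km θ (θ' - θ)) * nm t θ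
      = (∫ θ' in (-π)..(0:ℝ), Km θ' (θ - θ') * nm t θ') - V * sin θ * n t (-L) θ
  bc_periodic : ∀ t ≥ (0:ℝ), ∀ y ∈ Icc (-L) L, n t y (-π) = n t y π
  bc_top : ∀ t ≥ (0:ℝ), ∀ θ ∈ Ioo (-π) (0:ℝ),
    -(V * sin θ * n t L θ) = ∫ θ' in (0:ℝ)..π, Kp θ' (θ - θ') * np t θ'
  bc_bot : ∀ t ≥ (0:ℝ), ∀ θ ∈ Ioo (0:ℝ) π,
    V * sin θ * n t (-L) θ = ∫ θ' in (-π)..(0:ℝ), Km θ' (θ - θ') * nm t θ'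


lemma crtm_swap (a b c d : ℝ) (f : ℝ → ℝ → ℝ) (hf : Continuous (fun p : ℝ × ℝ => f p.1 p.2)) :
    (∫ x in a..b, ∫ y in c..d, f x y) = ∫ y in c..d, ∫ x in a..b, f x y := by
  apply MeasureTheory.intervalIntegral_intervalIntegral_swap
  have h : IntegrableOn (Function.uncurry f) (uIcc a b ×ˢ uIcc c d) (volume.prod volume) :=
    ContinuousOn.integrableOn_compact (isCompact_uIcc.prod isCompact_uIcc) hf.continuousOn
  exact h.mono_set (prod_mono uIoc_subset_uIcc uIoc_subset_uIcc)

lemma crtm_cont {X : Type*} [TopologicalSpace X] (a b : ℝ) (f : X → ℝ → ℝ)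
    (hf : Continuous (fun p : X × ℝ => f p.1 p.2)) : Continuous (fun x => ∫ y in a..b, f x y) :=
  intervalIntegral.continuous_parametric_intervalIntegral_of_continuous' hf a b

lemma crtm_deriv (a b : ℝ) (f f' : ℝ → ℝ → ℝ) (hf : Continuous (fun p : ℝ × ℝ => f p.1 p.2))
    (hf' : Continuous (fun p : ℝ × ℝ => f' p.1 p.2))
    (h : ∀ t x, HasDerivAt (fun s => f s x) (f' t x) t) (t : ℝ) :
    HasDerivAt (fun s => ∫ x in a..b, f s x) (∫ x in a..b, f' t x) t := by
  obtain ⟨C, hC⟩ := (isCompact_Icc.prod isCompact_uIcc :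
    IsCompact (Icc (t-1) (t+1) ×ˢ uIcc a b)).exists_bound_of_continuousOn hf'.continuousOn
  refine (intervalIntegral.hasDerivAt_integral_of_dominated_loc_of_deriv_le
    (F := f) (F' := f') (s := Icc (t-1) (t+1)) (bound := fun _ => C)
    (Icc_mem_nhds (by linarith) (by linarith)) ?_ ?_ ?_ ?_ ?_ ?_).2
  · refine Filter.Eventually.of_forall fun x => ?_
    have : Continuous (f x) := hf.comp (by fun_prop : Continuous fun y : ℝ => (x, y))
    exact this.aestronglyMeasurable
  · have : Continuous (f t) := hf.comp (by fun_prop : Continuous fun y : ℝ => (t, y))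
    exact this.intervalIntegrable _ _
  · have : Continuous (f' t) := hf'.comp (by fun_prop : Continuous fun y : ℝ => (t, y))
    exact this.aestronglyMeasurable
  · exact Filter.Eventually.of_forall fun y hy x hx => hC (x, y) ⟨hx, uIoc_subset_uIcc hy⟩
  · exact intervalIntegrable_const
  · exact Filter.Eventually.of_forall fun y hy x hx => h x y

/-- The partial derivative along a line in a direction `v`. -/
lemma crtm_part {E : Type*} [NormedAddCommGroup E] [NormedSpace ℝ E] (F : E → ℝ)
    (hF : ContDiff ℝ 1 F) (v : E) (c : ℝ → E) (t : ℝ) (hc : HasDerivAt c v t) :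
    HasDerivAt (fun s => F (c s)) (fderiv ℝ F (c t) v) t :=
  ((hF.differentiable one_ne_zero) (c t)).hasFDerivAt.comp_hasDerivAt t hc

lemma crtm_fd_cont {E : Type*} [NormedAddCommGroup E] [NormedSpace ℝ E] (F : E → ℝ)
    (hF : ContDiff ℝ 1 F) (v : E) : Continuous (fun p => fderiv ℝ F p v) :=
  (hF.continuous_fderiv one_ne_zero).clm_apply continuous_const

/-- Gain-loss balance. -/
lemma crtm_balance (a b c d : ℝ) (K : ℝ → ℝ → ℝ) (u : ℝ → ℝ)
    (hK : Continuous (fun p : ℝ × ℝ => K p.1 p.2)) (hu : Continuous u) :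
    (∫ θ in a..b, (∫ θ' in c..d, K θ (θ' - θ)) * u θ)
      = ∫ θ in c..d, ∫ θ' in a..b, K θ' (θ - θ') * u θ' := by
  rw [← crtm_swap a b c d (fun x y => K x (y - x) * u x)]
  · simp only [intervalIntegral.integral_mul_const]
  · exact (hK.comp (by fun_prop : Continuous fun p : ℝ × ℝ => (p.1, p.2 - p.1))).mul
      (hu.comp continuous_fst)

lemma crtm_gain_cont (a b : ℝ) (K : ℝ → ℝ → ℝ) (u : ℝ → ℝ)
    (hK : Continuous (fun p : ℝ × ℝ => K p.1 p.2)) (hu : Continuous u) :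
    Continuous fun θ => ∫ θ' in a..b, K θ' (θ - θ') * u θ' :=
  crtm_cont a b (fun θ θ' => K θ' (θ - θ') * u θ')
    ((hK.comp (by fun_prop : Continuous fun p : ℝ × ℝ => (p.2, p.1 - p.2))).mul
      (hu.comp continuous_snd))

lemma crtm_loss_cont (c d : ℝ) (K : ℝ → ℝ → ℝ) (u : ℝ → ℝ)
    (hK : Continuous (fun p : ℝ × ℝ => K p.1 p.2)) (hu : Continuous u) :
    Continuous fun θ => (∫ θ' in c..d, K θ (θ' - θ)) * u θ :=
  (crtm_cont c d (fun θ θ' => K θ (θ' - θ))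
    (hK.comp (by fun_prop : Continuous fun p : ℝ × ℝ => (p.1, p.2 - p.1)))).mul hu

/-- **Theorem 2.1 (mass conservation).** For a classical solution of the CRTM, the total
mass `M(t) = ∫_{−L}^{L}∫_{−π}^{π} n dθ dy + ∫_0^{π} n₊ dθ + ∫_{−π}^{0} n₋ dθ` is constant. -/
theorem crtm_mass_conservation
    (V L : ℝ) (hV : 0 < V) (hL : 0 < L)
    (K : ℝ → ℝ → ℝ → ℝ) (Kp : ℝ → ℝ → ℝ) (Km : ℝ → ℝ → ℝ)
    (hKc : Continuous (fun p : ℝ × ℝ × ℝ => K p.1 p.2.1 p.2.2))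
    (hKpc : Continuous (fun p : ℝ × ℝ => Kp p.1 p.2))
    (hKmc : Continuous (fun p : ℝ × ℝ => Km p.1 p.2))
    (hKnn : ∀ y θ z, 0 ≤ K y θ z)
    (hKpnn : ∀ θ z, 0 ≤ Kp θ z)
    (hKmnn : ∀ θ z, 0 ≤ Km θ z)
    (n : ℝ → ℝ → ℝ → ℝ) (np : ℝ → ℝ → ℝ) (nm : ℝ → ℝ → ℝ)
    (hsol : IsCRTMSolution V L K Kp Km n np nm) :
    ∀ t ≥ (0:ℝ),
      (∫ y in (-L)..L, ∫ θ in (-π)..π, n t y θ)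
        + (∫ θ in (0:ℝ)..π, np t θ) + (∫ θ in (-π)..(0:ℝ), nm t θ)
      = (∫ y in (-L)..L, ∫ θ in (-π)..π, n 0 y θ)
        + (∫ θ in (0:ℝ)..π, np 0 θ) + (∫ θ in (-π)..(0:ℝ), nm 0 θ) := by
  have hsn := hsol.smooth_n
  have hsp := hsol.smooth_np
  have hsm := hsol.smooth_nm
  obtain ⟨Dt, hDt⟩ : ∃ D, D = fun p => fderiv ℝ (fun p : ℝ × ℝ × ℝ => n p.1 p.2.1 p.2.2) p (1,0,0) :=
    ⟨_, rfl⟩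
  obtain ⟨Dy, hDy⟩ : ∃ D, D = fun p => fderiv ℝ (fun p : ℝ × ℝ × ℝ => n p.1 p.2.1 p.2.2) p (0,1,0) :=
    ⟨_, rfl⟩
  obtain ⟨Dp, hDp⟩ : ∃ D, D = fun p => fderiv ℝ (fun p : ℝ × ℝ => np p.1 p.2) p (1,0) :=
    ⟨_, rfl⟩
  obtain ⟨Dm, hDm⟩ : ∃ D, D = fun p => fderiv ℝ (fun p : ℝ × ℝ => nm p.1 p.2) p (1,0) :=
    ⟨_, rfl⟩
  have cDt : Continuous Dt := hDt ▸ crtm_fd_cont _ hsn _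
  have cDy : Continuous Dy := hDy ▸ crtm_fd_cont _ hsn _
  have cDp : Continuous Dp := hDp ▸ crtm_fd_cont _ hsp _
  have cDm : Continuous Dm := hDm ▸ crtm_fd_cont _ hsm _
  have dt : ∀ t y θ, HasDerivAt (fun s => n s y θ) (Dt (t, y, θ)) t := fun t y θ => by
    rw [hDt]
    exact crtm_part _ hsn _ (fun s => (s, y, θ)) t
      ((hasDerivAt_id t).prodMk ((hasDerivAt_const t y).prodMk (hasDerivAt_const t θ)))
  have dy : ∀ t y θ, HasDerivAt (fun s => n t s θ) (Dy (t, y, θ)) y := fun t y θ => by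
    rw [hDy]
    exact crtm_part _ hsn _ (fun s => (t, s, θ)) y
      ((hasDerivAt_const y t).prodMk ((hasDerivAt_id y).prodMk (hasDerivAt_const y θ)))
  have dp : ∀ t θ, HasDerivAt (fun s => np s θ) (Dp (t, θ)) t := fun t θ => by
    rw [hDp]
    exact crtm_part _ hsp _ (fun s => (s, θ)) t
      ((hasDerivAt_id t).prodMk (hasDerivAt_const t θ))
  have dm : ∀ t θ, HasDerivAt (fun s => nm s θ) (Dm (t, θ)) t := fun t θ => by
    rw [hDm]
    exact crtm_part _ hsm _ (fun s => (s, θ)) t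
      ((hasDerivAt_id t).prodMk (hasDerivAt_const t θ))
  have cn := hsn.continuous
  have cp := hsp.continuous
  have cm := hsm.continuous
  have hpi := Real.pi_pos
  have hM : ∀ t, HasDerivAt (fun t => (∫ y in (-L)..L, ∫ θ in (-π)..π, n t y θ)
        + (∫ θ in (0:ℝ)..π, np t θ) + (∫ θ in (-π)..(0:ℝ), nm t θ))
        ((∫ y in (-L)..L, ∫ θ in (-π)..π, Dt (t, y, θ))
        + (∫ θ in (0:ℝ)..π, Dp (t, θ)) + (∫ θ in (-π)..(0:ℝ), Dm (t, θ))) t := by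
    intro t
    refine HasDerivAt.add (HasDerivAt.add ?_ ?_) ?_
    · refine crtm_deriv (-L) L (fun t y => ∫ θ in (-π)..π, n t y θ)
        (fun t y => ∫ θ in (-π)..π, Dt (t, y, θ)) ?_ ?_ ?_ t
      · exact crtm_cont _ _ (fun (p : ℝ × ℝ) θ => n p.1 p.2 θ)
          (cn.comp (by fun_prop : Continuous fun q : (ℝ × ℝ) × ℝ => (q.1.1, q.1.2, q.2)))
      · exact crtm_cont _ _ (fun (p : ℝ × ℝ) θ => Dt (p.1, p.2, θ)) (by fun_prop)
      · intro t y
        exact crtm_deriv _ _ (fun t θ => n t y θ) (fun t θ => Dt (t, y, θ))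
          (cn.comp (by fun_prop : Continuous fun q : ℝ × ℝ => (q.1, y, q.2))) (by fun_prop)
          (fun t θ => dt t y θ) t
    · exact crtm_deriv _ _ np (fun t θ => Dp (t, θ)) cp (by fun_prop) dp t
    · exact crtm_deriv _ _ nm (fun t θ => Dm (t, θ)) cm (by fun_prop) dm t
  have hz : ∀ t ≥ (0:ℝ), ((∫ y in (-L)..L, ∫ θ in (-π)..π, Dt (t, y, θ))
        + (∫ θ in (0:ℝ)..π, Dp (t, θ)) + (∫ θ in (-π)..(0:ℝ), Dm (t, θ))) = 0 := by
    intro t ht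
    have cny : ∀ y, Continuous fun θ => n t y θ := fun y =>
      cn.comp (by fun_prop : Continuous fun θ : ℝ => (t, y, θ))
    have cpt : Continuous fun θ => np t θ := cp.comp (by fun_prop : Continuous fun θ : ℝ => (t, θ))
    have cmt : Continuous fun θ => nm t θ := cm.comp (by fun_prop : Continuous fun θ : ℝ => (t, θ))
    have cf : ∀ y, Continuous fun θ => V * sin θ * n t y θ := fun y =>
      (by fun_prop : Continuous fun θ => V * sin θ).mul (cny y)
    have h1 : (∫ y in (-L)..L, ∫ θ in (-π)..π, Dt (t, y, θ))
        = (∫ θ in (-π)..π, V * sin θ * n t (-L) θ) - ∫ θ in (-π)..π, V * sin θ * n t L θ := by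
      have e1 : (∫ y in (-L)..L, ∫ θ in (-π)..π, Dt (t, y, θ))
          = ∫ y in (-L)..L, ∫ θ in (-π)..π, -(V * sin θ * Dy (t, y, θ)) := by
        refine intervalIntegral.integral_congr_Ioo_of_le (by linarith) fun y hy => ?_
        have hKy : Continuous (fun p : ℝ × ℝ => K y p.1 p.2) :=
          hKc.comp (by fun_prop : Continuous fun p : ℝ × ℝ => (y, p.1, p.2))
        have cg := crtm_gain_cont (-π) π (K y) _ hKy (cny y)
        have cl := crtm_loss_cont (-π) π (K y) _ hKy (cny y)
        have cD : Continuous fun θ => -(V * sin θ * Dy (t, y, θ)) := by fun_prop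
        have e : (∫ θ in (-π)..π, Dt (t, y, θ)) = ∫ θ in (-π)..π,
            ((-(V * sin θ * Dy (t, y, θ)) + ∫ θ' in (-π)..π, K y θ' (θ - θ') * n t y θ')
              - (∫ θ' in (-π)..π, K y θ (θ' - θ)) * n t y θ) := by
          refine intervalIntegral.integral_congr_Ioo_of_le (by linarith) fun θ hθ => ?_
          have := hsol.interior_eq t ht y hy θ hθ
          rw [(dt t y θ).deriv, (dy t y θ).deriv] at this
          linarith
        rw [e, intervalIntegral.integral_sub ((cD.fun_add cg).intervalIntegrable _ _)
          (cl.intervalIntegrable _ _),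
          intervalIntegral.integral_add (cD.intervalIntegrable _ _) (cg.intervalIntegrable _ _),
          crtm_balance (-π) π (-π) π (K y) _ hKy (cny y)]
        ring
      rw [e1, crtm_swap _ _ _ _ (fun y θ => -(V * sin θ * Dy (t, y, θ))) (by fun_prop),
        ← intervalIntegral.integral_sub ((cf _).intervalIntegrable _ _)
          ((cf _).intervalIntegrable _ _)]
      refine intervalIntegral.integral_congr fun θ _ => ?_
      rw [intervalIntegral.integral_neg, intervalIntegral.integral_const_mul,
        intervalIntegral.integral_eq_sub_of_hasDerivAt (fun y _ => dy t y θ)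
          ((by fun_prop : Continuous fun y => Dy (t, y, θ)).intervalIntegrable _ _)]
      ring
    have h2 : (∫ θ in (0:ℝ)..π, Dp (t, θ)) = ∫ θ in (-π)..π, V * sin θ * n t L θ := by
      have cg := crtm_gain_cont 0 π Kp _ hKpc cpt
      have cl := crtm_loss_cont (-π) π Kp _ hKpc cpt
      have e : (∫ θ in (0:ℝ)..π, Dp (t, θ)) = ∫ θ in (0:ℝ)..π,
          ((V * sin θ * n t L θ + ∫ θ' in (0:ℝ)..π, Kp θ' (θ - θ') * np t θ')
              - (∫ θ' in (-π)..π, Kp θ (θ' - θ)) * np t θ) := by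
        refine intervalIntegral.integral_congr_Ioo_of_le (by linarith) fun θ hθ => ?_
        have := hsol.top_eq t ht θ hθ
        rw [(dp t θ).deriv] at this
        linarith
      have e2 : (∫ θ in (-π)..(0:ℝ), ∫ θ' in (0:ℝ)..π, Kp θ' (θ - θ') * np t θ')
          = ∫ θ in (-π)..(0:ℝ), -(V * sin θ * n t L θ) :=
        intervalIntegral.integral_congr_Ioo_of_le (by linarith)
          fun θ hθ => (hsol.bc_top t ht θ hθ).symm
      rw [e, intervalIntegral.integral_sub (((cf L).fun_add cg).intervalIntegrable _ _)
          (cl.intervalIntegrable _ _),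
          intervalIntegral.integral_add ((cf L).intervalIntegrable _ _) (cg.intervalIntegrable _ _),
          crtm_balance 0 π (-π) π Kp _ hKpc cpt,
          ← intervalIntegral.integral_add_adjacent_intervals (a := -π) (b := 0) (c := π)
            (cg.intervalIntegrable _ _) (cg.intervalIntegrable _ _),
          ← intervalIntegral.integral_add_adjacent_intervals (a := -π) (b := 0) (c := π)
            ((cf L).intervalIntegrable _ _) ((cf L).intervalIntegrable _ _), e2,
          intervalIntegral.integral_neg]
      ring
    have h3 : (∫ θ in (-π)..(0:ℝ), Dm (t, θ)) = -∫ θ in (-π)..π, V * sin θ * n t (-L) θ := by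
      have cg := crtm_gain_cont (-π) 0 Km _ hKmc cmt
      have cl := crtm_loss_cont (-π) π Km _ hKmc cmt
      have e : (∫ θ in (-π)..(0:ℝ), Dm (t, θ)) = ∫ θ in (-π)..(0:ℝ),
          (((∫ θ' in (-π)..(0:ℝ), Km θ' (θ - θ') * nm t θ') - V * sin θ * n t (-L) θ)
              - (∫ θ' in (-π)..π, Km θ (θ' - θ)) * nm t θ) := by
        refine intervalIntegral.integral_congr_Ioo_of_le (by linarith) fun θ hθ => ?_
        have := hsol.bot_eq t ht θ hθ
        rw [(dm t θ).deriv] at this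
        linarith
      have e2 : (∫ θ in (0:ℝ)..π, ∫ θ' in (-π)..(0:ℝ), Km θ' (θ - θ') * nm t θ')
          = ∫ θ in (0:ℝ)..π, V * sin θ * n t (-L) θ :=
        intervalIntegral.integral_congr_Ioo_of_le (by linarith)
          fun θ hθ => (hsol.bc_bot t ht θ hθ).symm
      rw [e, intervalIntegral.integral_sub ((cg.fun_sub (cf (-L))).intervalIntegrable _ _)
          (cl.intervalIntegrable _ _),
          intervalIntegral.integral_sub (cg.intervalIntegrable _ _)
            ((cf (-L)).intervalIntegrable _ _),
          crtm_balance (-π) 0 (-π) π Km _ hKmc cmt,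
          ← intervalIntegral.integral_add_adjacent_intervals (a := -π) (b := 0) (c := π)
            (cg.intervalIntegrable _ _) (cg.intervalIntegrable _ _),
          ← intervalIntegral.integral_add_adjacent_intervals (a := -π) (b := 0) (c := π)
            ((cf (-L)).intervalIntegrable _ _) ((cf (-L)).intervalIntegrable _ _), e2]
      ring
    rw [h1, h2, h3]
    ring
  intro t ht
  exact constant_of_has_deriv_right_zero (a := 0) (b := t)
    (fun s _ => (hM s).continuousAt.continuousWithinAt)
    (fun s hs => by
      have h := hM s
      rw [hz s hs.1] at h
      exact h.hasDerivWithinAt) t ⟨ht, le_refl t⟩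
end
end

section
/- Lower-boundary mass balance (third step of the proof of Theorem 2.1). Let n₋ : [0,∞)×[−π,0] → ℝ be C¹ and n(t,−L,θ) a continuous function on [0,∞)×[−π,π] such that equation (iii) holds for θ ∈ (−π,0) and the boundary condition (vi) holds for θ ∈ (0,π). Then for every t ≥ 0, d/dt ∫_{−π}^{0} n₋(t,θ) dθ = −∫_{−π}^{π} V sin θ · n(t,−L,θ) dθ. -/
open MeasureTheory Real Set

noncomputable section

/-- **Lower-boundary mass balance** (third step of the proof of Theorem 2.1).
If `n₋` is `C¹`, `nL(t,θ) = n(t,−L,θ)` is continuous, equation (iii) holds for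
`θ ∈ (−π,0)` and the boundary condition (vi) holds for `θ ∈ (0,π)`, then
`d/dt ∫_{−π}^{0} n₋(t,θ) dθ = −∫_{−π}^{π} V sin θ · n(t,−L,θ) dθ` for every `t ≥ 0`. -/
theorem crtm_lower_boundary_mass_balance
    (V L : ℝ) (hV : 0 < V) (hL : 0 < L)
    (Km : ℝ → ℝ → ℝ)
    (hKmc : Continuous (fun p : ℝ × ℝ => Km p.1 p.2))
    (hKmnn : ∀ θ z, 0 ≤ Km θ z)
    (nm : ℝ → ℝ → ℝ) (nL : ℝ → ℝ → ℝ)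
    (hnm : ContDiff ℝ 1 (fun p : ℝ × ℝ => nm p.1 p.2))
    (hnL : ContinuousOn (fun p : ℝ × ℝ => nL p.1 p.2) (Ici 0 ×ˢ Icc (-π) π))
    (heq : ∀ t ≥ (0:ℝ), ∀ θ ∈ Ioo (-π) (0:ℝ),
      deriv (fun s => nm s θ) t + (∫ θ' in (-π)..π, Km θ (θ' - θ)) * nm t θ
        = (∫ θ' in (-π)..(0:ℝ), Km θ' (θ - θ') * nm t θ') - V * sin θ * nL t θ)
    (hbc : ∀ t ≥ (0:ℝ), ∀ θ ∈ Ioo (0:ℝ) π,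
      V * sin θ * nL t θ = ∫ θ' in (-π)..(0:ℝ), Km θ' (θ - θ') * nm t θ') :
    ∀ t ≥ (0:ℝ),
      HasDerivAt (fun s => ∫ θ in (-π)..(0:ℝ), nm s θ)
        (-∫ θ in (-π)..π, V * sin θ * nL t θ) t := by
  intro t ht
  have hpi : (0:ℝ) < π := Real.pi_pos
  -- the time derivative
  let G : ℝ × ℝ → ℝ := fun p => fderiv ℝ (fun p : ℝ × ℝ => nm p.1 p.2) p (1, 0)
  have hG : Continuous G := (hnm.continuous_fderiv one_ne_zero).clm_apply continuous_const
  have hD : ∀ s θ, HasDerivAt (fun s => nm s θ) (G (s, θ)) s := by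
    intro s θ
    have h1 := (hnm.differentiable one_ne_zero (s, θ)).hasFDerivAt
    have h2 : HasDerivAt (fun s : ℝ => (s, θ)) ((1:ℝ), (0:ℝ)) s :=
      (hasDerivAt_id s).prodMk (hasDerivAt_const s θ)
    exact h1.comp_hasDerivAt s h2
  have hnc : ∀ s, Continuous (nm s) := fun s =>
    hnm.continuous.comp (by fun_prop : Continuous fun θ : ℝ => (s, θ))
  have hGc : ∀ s, Continuous (fun θ => G (s, θ)) := fun s => hG.comp (by fun_prop)
  have hcomp : IsCompact (Icc (t - 1) (t + 1) ×ˢ Icc (-π) (0:ℝ)) := isCompact_Icc.prod isCompact_Icc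
  obtain ⟨C, hC⟩ := hcomp.exists_bound_of_continuousOn hG.continuousOn
  have hder := (intervalIntegral.hasDerivAt_integral_of_dominated_loc_of_deriv_le
    (μ := volume) (a := -π) (b := 0) (F := nm) (F' := fun s θ => G (s, θ)) (x₀ := t)
    (s := Icc (t - 1) (t + 1)) (bound := fun _ => C)
    (Icc_mem_nhds (by linarith) (by linarith))
    (Filter.Eventually.of_forall fun s => (hnc s).aestronglyMeasurable)
    ((hnc t).intervalIntegrable _ _)
    (hGc t).aestronglyMeasurable
    (Filter.Eventually.of_forall fun θ hθ s hs => by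
      rw [uIoc_of_le (by linarith)] at hθ
      exact hC (s, θ) ⟨hs, hθ.1.le, hθ.2⟩)
    (by simp)
    (Filter.Eventually.of_forall fun θ _ s _ => hD s θ)).2
  -- continuity of the gain and loss terms
  have hnt : Continuous (nm t) := hnc t
  have hF : Continuous (Function.uncurry fun θ θ' : ℝ => Km θ' (θ - θ') * nm t θ') := by
    have h1 : Continuous fun p : ℝ × ℝ => Km p.2 (p.1 - p.2) :=
      hKmc.comp (by fun_prop : Continuous fun p : ℝ × ℝ => (p.2, p.1 - p.2))
    exact h1.mul (hnt.comp continuous_snd)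
  have hk : Continuous fun θ : ℝ => ∫ θ' in (-π)..π, Km θ (θ' - θ) := by
    apply intervalIntegral.continuous_parametric_intervalIntegral_of_continuous'
    exact hKmc.comp (by fun_prop : Continuous fun p : ℝ × ℝ => (p.1, p.2 - p.1))
  let J : ℝ → ℝ := fun θ => ∫ θ' in (-π)..(0:ℝ), Km θ' (θ - θ') * nm t θ'
  have hJ : Continuous J :=
    intervalIntegral.continuous_parametric_intervalIntegral_of_continuous' hF _ _
  have hswap : ∫ θ in (-π)..π, J θ
      = ∫ θ in (-π)..(0:ℝ), (∫ θ' in (-π)..π, Km θ (θ' - θ)) * nm t θ := by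
    simp only [J]
    rw [intervalIntegral_intervalIntegral_swap]
    · simp only [intervalIntegral.integral_mul_const]
    · refine (hF.continuousOn.integrableOn_compact
        (isCompact_uIcc.prod isCompact_uIcc)).mono_set
        (prod_mono uIoc_subset_uIcc uIoc_subset_uIcc)
  have hfc : ContinuousOn (fun θ => V * sin θ * nL t θ) (Icc (-π) π) := by
    have h1 : ContinuousOn (fun θ => nL t θ) (Icc (-π) π) :=
      hnL.comp (by fun_prop : ContinuousOn (fun θ : ℝ => (t, θ)) (Icc (-π) π))
        (fun θ hθ => ⟨ht, hθ⟩)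
    exact (by fun_prop : ContinuousOn (fun θ : ℝ => V * sin θ) (Icc (-π) π)).mul h1
  have hi1 : IntervalIntegrable (fun θ => V * sin θ * nL t θ) volume (-π) 0 :=
    (hfc.mono (Icc_subset_Icc le_rfl hpi.le)).intervalIntegrable_of_Icc (by linarith)
  have hi2 : IntervalIntegrable (fun θ => V * sin θ * nL t θ) volume 0 π :=
    (hfc.mono (Icc_subset_Icc (by linarith) le_rfl)).intervalIntegrable_of_Icc hpi.le
  have e1 : ∫ θ in (-π)..(0:ℝ), G (t, θ) = ∫ θ in (-π)..(0:ℝ),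
      (J θ - (∫ θ' in (-π)..π, Km θ (θ' - θ)) * nm t θ - V * sin θ * nL t θ) := by
    apply intervalIntegral.integral_congr_Ioo_of_le (by linarith)
    intro θ hθ
    have h := heq t ht θ hθ
    rw [(hD t θ).deriv] at h
    simp only [J]
    linarith
  have e2 : ∫ θ in (0:ℝ)..π, V * sin θ * nL t θ = ∫ θ in (0:ℝ)..π, J θ :=
    intervalIntegral.integral_congr_Ioo_of_le hpi.le (fun θ hθ => hbc t ht θ hθ)
  have hkn : Continuous fun θ : ℝ => (∫ θ' in (-π)..π, Km θ (θ' - θ)) * nm t θ := hk.mul hnt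
  have hJk : Continuous fun θ : ℝ => J θ - (∫ θ' in (-π)..π, Km θ (θ' - θ)) * nm t θ :=
    hJ.sub hkn
  rw [intervalIntegral.integral_sub
      (hJk.intervalIntegrable _ _) hi1,
    intervalIntegral.integral_sub (hJ.intervalIntegrable _ _) (hkn.intervalIntegrable _ _),
    ← hswap, ← intervalIntegral.integral_add_adjacent_intervals
      (hJ.intervalIntegrable (-π) 0) (hJ.intervalIntegrable 0 π)] at e1
  have e3 := intervalIntegral.integral_add_adjacent_intervals hi1 hi2
  have e4 : ∫ θ in (-π)..(0:ℝ), G (t, θ) = -∫ θ in (-π)..π, V * sin θ * nL t θ := by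
    rw [e1, ← e3, e2]; ring
  rw [← e4]
  exact hder
end
end

section
/- Relative entropy identity (equality part of Theorem 3.1). Let (n, n₊, n₋) be a classical solution of the CRTM on [0,∞), let (m, m₊, m₋) be a positive stationary state, define the relative gaps ω, ω₊, ω₋, ω₊L, ω₋L, and let H ∈ C²(ℝ). Then for every t ≥ 0, d/dt [ ∫_{−L}^{L}∫_{−π}^{π} m(y,θ) H(ω(t,y,θ)) dθ dy + ∫_0^{π} m₊(θ) H(ω₊(t,θ)) dθ + ∫_{−π}^{0} m₋(θ) H(ω₋(t,θ)) dθ ] = D1(t) + D1₊(t) + D1₋(t) + D2₊(t) + D2₋(t) + D3₊(t) + D3₋(t). -/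
open MeasureTheory Real Set

noncomputable section

/-- Interior dissipation `D_H^{(1)}(t)`. -/
def D1 (L : ℝ) (K : ℝ → ℝ → ℝ → ℝ) (m : ℝ → ℝ → ℝ) (H : ℝ → ℝ)
    (ω : ℝ → ℝ → ℝ → ℝ) (t : ℝ) : ℝ :=
  -∫ y in (-L)..L, ∫ θ in (-π)..π, ∫ θ' in (-π)..π,
    K y θ' (θ - θ') * m y θ' *
      (H (ω t y θ') - H (ω t y θ) - deriv H (ω t y θ) * (ω t y θ' - ω t y θ))

/-- Upper-boundary dissipation `D_{H,+}^{(1)}(t)`. -/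
def D1p (Kp : ℝ → ℝ → ℝ) (mp : ℝ → ℝ) (H : ℝ → ℝ) (ωp : ℝ → ℝ → ℝ) (t : ℝ) : ℝ :=
  -∫ θ in (0:ℝ)..π, ∫ θ' in (0:ℝ)..π,
    Kp θ' (θ - θ') * mp θ' *
      (H (ωp t θ') - H (ωp t θ) - deriv H (ωp t θ) * (ωp t θ' - ωp t θ))

/-- Lower-boundary dissipation `D_{H,−}^{(1)}(t)`. -/
def D1m (Km : ℝ → ℝ → ℝ) (mm : ℝ → ℝ) (H : ℝ → ℝ) (ωm : ℝ → ℝ → ℝ) (t : ℝ) : ℝ :=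
  -∫ θ in (-π)..(0:ℝ), ∫ θ' in (-π)..(0:ℝ),
    Km θ' (θ - θ') * mm θ' *
      (H (ωm t θ') - H (ωm t θ) - deriv H (ωm t θ) * (ωm t θ' - ωm t θ))

/-- Dissipation `D_{H,+}^{(2)}(t)` of the state transition interior → upper boundary. -/
def D2p (V : ℝ) (mL : ℝ → ℝ) (H : ℝ → ℝ) (ωpL ωp : ℝ → ℝ → ℝ) (t : ℝ) : ℝ :=
  -∫ θ in (0:ℝ)..π, V * sin θ * mL θ *
      (H (ωpL t θ) - H (ωp t θ) - deriv H (ωp t θ) * (ωpL t θ - ωp t θ))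

/-- Dissipation `D_{H,−}^{(2)}(t)` of the state transition interior → lower boundary. -/
def D2m (V : ℝ) (mmL : ℝ → ℝ) (H : ℝ → ℝ) (ωmL ωm : ℝ → ℝ → ℝ) (t : ℝ) : ℝ :=
  ∫ θ in (-π)..(0:ℝ), V * sin θ * mmL θ *
      (H (ωmL t θ) - H (ωm t θ) - deriv H (ωm t θ) * (ωmL t θ - ωm t θ))

/-- Dissipation `D_{H,+}^{(3)}(t)` of the state transition upper boundary → interior. -/
def D3p (Kp : ℝ → ℝ → ℝ) (mp : ℝ → ℝ) (H : ℝ → ℝ) (ωp ωpL : ℝ → ℝ → ℝ) (t : ℝ) : ℝ :=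
  -∫ θ in (-π)..(0:ℝ), ∫ θ' in (0:ℝ)..π,
    Kp θ' (θ - θ') * mp θ' *
      (H (ωp t θ') - H (ωpL t θ) - deriv H (ωpL t θ) * (ωp t θ' - ωpL t θ))

/-- Dissipation `D_{H,−}^{(3)}(t)` of the state transition lower boundary → interior. -/
def D3m (Km : ℝ → ℝ → ℝ) (mm : ℝ → ℝ) (H : ℝ → ℝ) (ωm ωmL : ℝ → ℝ → ℝ) (t : ℝ) : ℝ :=
  -∫ θ in (0:ℝ)..π, ∫ θ' in (-π)..(0:ℝ),
    Km θ' (θ - θ') * mm θ' *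
      (H (ωm t θ') - H (ωmL t θ) - deriv H (ωmL t θ) * (ωm t θ' - ωmL t θ))

lemma aux_swap (a b c d : ℝ) (f : ℝ × ℝ → ℝ) (hf : Continuous f) :
    (∫ x in a..b, ∫ y in c..d, f (x, y)) = ∫ y in c..d, ∫ x in a..b, f (x, y) := by
  apply intervalIntegral_intervalIntegral_swap
  refine IntegrableOn.mono_set (t := uIcc a b ×ˢ uIcc c d) ?_
    (prod_mono uIoc_subset_uIcc uIoc_subset_uIcc)
  exact hf.continuousOn.integrableOn_compact (isCompact_uIcc.prod isCompact_uIcc)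

lemma aux_deriv (a b : ℝ) (f f' : ℝ × ℝ → ℝ) (hf : Continuous f) (hf' : Continuous f')
    (h : ∀ s x, HasDerivAt (fun s => f (s, x)) (f' (s, x)) s) (t : ℝ) :
    HasDerivAt (fun s => ∫ x in a..b, f (s, x)) (∫ x in a..b, f' (t, x)) t := by
  obtain ⟨C, hC⟩ := ((isCompact_Icc (a := t - 1) (b := t + 1)).prod
    (isCompact_uIcc (a := a) (b := b))).exists_bound_of_continuousOn hf'.continuousOn
  refine (intervalIntegral.hasDerivAt_integral_of_dominated_loc_of_deriv_le
    (s := Icc (t - 1) (t + 1)) (bound := fun _ => C)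
    (F := fun s x => f (s, x)) (F' := fun s x => f' (s, x))
    (Icc_mem_nhds (by linarith) (by linarith)) ?_ ?_ ?_ ?_ ?_ ?_).2
  · filter_upwards with x
    exact Continuous.aestronglyMeasurable (by fun_prop)
  · exact Continuous.intervalIntegrable (by fun_prop) _ _
  · exact Continuous.aestronglyMeasurable (by fun_prop)
  · filter_upwards with x hx s hs
    exact hC (s, x) ⟨hs, uIoc_subset_uIcc hx⟩
  · exact Continuous.intervalIntegrable (by fun_prop) _ _
  · filter_upwards with x hx s hs
    exact h s x

/-- expand inner integral -/
lemma aux_expand (a b : ℝ) (u g p : ℝ → ℝ) (hu : Continuous u) (hg : Continuous g)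
    (hp : Continuous p) (h0 e q : ℝ) :
    (∫ x in a..b, u x * (g x - h0 - e * (p x - q)))
      = (∫ x in a..b, u x * g x) - h0 * (∫ x in a..b, u x)
        - e * ((∫ x in a..b, u x * p x) - q * ∫ x in a..b, u x) := by
  have i1 : IntervalIntegrable (fun x => u x * g x) volume a b :=
    Continuous.intervalIntegrable (by fun_prop) _ _
  have i2 : IntervalIntegrable (fun x => h0 * u x) volume a b :=
    Continuous.intervalIntegrable (by fun_prop) _ _
  have i3 : IntervalIntegrable (fun x => e * (u x * p x)) volume a b :=
    Continuous.intervalIntegrable (by fun_prop) _ _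
  have i4 : IntervalIntegrable (fun x => (e * q) * u x) volume a b :=
    Continuous.intervalIntegrable (by fun_prop) _ _
  have : (∫ x in a..b, u x * (g x - h0 - e * (p x - q)))
      = ∫ x in a..b, (((u x * g x - h0 * u x) - e * (u x * p x)) + (e * q) * u x) := by
    congr 1; ext x; ring
  rw [this, intervalIntegral.integral_add ((i1.sub i2).sub i3) i4,
    intervalIntegral.integral_sub (i1.sub i2) i3, intervalIntegral.integral_sub i1 i2]
  simp only [intervalIntegral.integral_const_mul]
  ring

lemma aux_wall {a b c d : ℝ} (hab : a ≤ b) (hcd : c ≤ d) (κ : ℝ × ℝ → ℝ) (hκ : Continuous κ)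
    (S mp p q r H H' : ℝ → ℝ) (hS : Continuous S) (hmp : Continuous mp) (hp : Continuous p)
    (hq : Continuous q) (hH : Continuous H) (hH' : Continuous H')
    (h1 : ∀ θ ∈ Ioo a b, r θ + ((∫ θ' in a..b, κ (θ, θ')) + ∫ θ' in c..d, κ (θ, θ')) * (mp θ * p θ)
      = (∫ θ' in a..b, (κ (θ', θ) * mp θ') * p θ') + S θ * q θ)
    (h2 : ∀ θ ∈ Ioo a b, ((∫ θ' in a..b, κ (θ, θ')) + ∫ θ' in c..d, κ (θ, θ')) * mp θ
      = (∫ θ' in a..b, κ (θ', θ) * mp θ') + S θ)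
    (h3 : ∀ θ ∈ Ioo c d, -(S θ * q θ) = ∫ θ' in a..b, (κ (θ', θ) * mp θ') * p θ')
    (h4 : ∀ θ ∈ Ioo c d, -(S θ) = ∫ θ' in a..b, κ (θ', θ) * mp θ') :
    (∫ θ in a..b, H' (p θ) * r θ)
      = (-∫ θ in a..b, ∫ θ' in a..b, κ (θ', θ) * mp θ' *
            (H (p θ') - H (p θ) - H' (p θ) * (p θ' - p θ)))
        + (-∫ θ in a..b, S θ * (H (q θ) - H (p θ) - H' (p θ) * (q θ - p θ)))
        + (-∫ θ in c..d, ∫ θ' in a..b, κ (θ', θ) * mp θ' *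
            (H (p θ') - H (q θ) - H' (q θ) * (p θ' - q θ)))
        + (∫ θ in a..b, S θ * H (q θ)) + ∫ θ in c..d, S θ * H (q θ) := by
  have ex : ∀ θ h0 e q', (∫ θ' in a..b, κ (θ', θ) * mp θ' * (H (p θ') - h0 - e * (p θ' - q')))
     = _ := fun θ h0 e q' => aux_expand a b (fun θ' => κ (θ', θ) * mp θ') (fun θ' => H (p θ')) p
      (by fun_prop) (by fun_prop) hp h0 e q'
  have e1 : (∫ θ in a..b, H' (p θ) * r θ) = ∫ θ in a..b,
      ((-(∫ θ' in a..b, κ (θ', θ) * mp θ' *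
            (H (p θ') - H (p θ) - H' (p θ) * (p θ' - p θ)))
        + -(S θ * (H (q θ) - H (p θ) - H' (p θ) * (q θ - p θ))) + S θ * H (q θ))
        + ((∫ θ' in a..b, κ (θ', θ) * mp θ' * H (p θ')) - ∫ θ' in a..b, κ (θ, θ') * mp θ * H (p θ))
        - ∫ θ' in c..d, κ (θ, θ') * mp θ * H (p θ)) := by
    apply intervalIntegral.integral_congr_Ioo_of_le hab
    intro θ hθ
    have h1 := h1 θ hθ
    have h2 := h2 θ hθ
    simp only [intervalIntegral.integral_mul_const, ex]
    linear_combination H' (p θ) * h1 + (H (p θ) - p θ * H' (p θ)) * h2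
  have e2 : (∫ θ in c..d, S θ * H (q θ)) = ∫ θ in c..d,
      ((∫ θ' in a..b, κ (θ', θ) * mp θ' *
            (H (p θ') - H (q θ) - H' (q θ) * (p θ' - q θ)))
        - ∫ θ' in a..b, κ (θ', θ) * mp θ' * H (p θ')) := by
    apply intervalIntegral.integral_congr_Ioo_of_le hcd
    intro θ hθ
    have h3 := h3 θ hθ
    have h4 := h4 θ hθ
    simp only [ex]
    linear_combination -H' (q θ) * h3 + (-H (q θ) + q θ * H' (q θ)) * h4
  have sw1 := aux_swap a b a b (fun z => κ (z.2, z.1) * mp z.2 * H (p z.2)) (by fun_prop)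
  have sw2 := aux_swap c d a b (fun z => κ (z.2, z.1) * mp z.2 * H (p z.2)) (by fun_prop)
  simp only at sw1 sw2
  rw [e1, e2]
  rw [intervalIntegral.integral_sub, intervalIntegral.integral_add, intervalIntegral.integral_add,
    intervalIntegral.integral_add, intervalIntegral.integral_sub, intervalIntegral.integral_sub,
    intervalIntegral.integral_neg, intervalIntegral.integral_neg, sw1, sw2]
  · ring
  all_goals exact Continuous.intervalIntegrable (by fun_prop) _ _

lemma aux_int {a b L : ℝ} (hab : a ≤ b) (hL : -L ≤ L) (κ : ℝ × ℝ × ℝ → ℝ) (hκ : Continuous κ)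
    (m w nt ny my : ℝ × ℝ → ℝ) (S H H' : ℝ → ℝ) (hS : Continuous S) (hm : Continuous m)
    (hw : Continuous w) (hny : Continuous ny) (hmy : Continuous my)
    (hH : Continuous H) (hH' : Continuous H')
    (h1 : ∀ y ∈ Ioo (-L) L, ∀ θ ∈ Ioo a b, nt (y, θ) + S θ * ny (y, θ)
        + (∫ θ' in a..b, κ (y, θ, θ')) * (m (y, θ) * w (y, θ))
      = (∫ θ' in a..b, (κ (y, θ', θ) * m (y, θ')) * w (y, θ')))
    (h2 : ∀ y ∈ Ioo (-L) L, ∀ θ ∈ Ioo a b, S θ * my (y, θ)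
        + (∫ θ' in a..b, κ (y, θ, θ')) * m (y, θ)
      = (∫ θ' in a..b, κ (y, θ', θ) * m (y, θ')))
    (h3 : ∀ y ∈ Ioo (-L) L, ∀ θ ∈ Ioo a b, HasDerivAt (fun z => m (z, θ) * H (w (z, θ)))
      (my (y, θ) * (H (w (y, θ)) - w (y, θ) * H' (w (y, θ))) + H' (w (y, θ)) * ny (y, θ)) y) :
    (∫ y in (-L)..L, ∫ θ in a..b, H' (w (y, θ)) * nt (y, θ))
      = (-∫ y in (-L)..L, ∫ θ in a..b, ∫ θ' in a..b, κ (y, θ', θ) * m (y, θ') *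
            (H (w (y, θ')) - H (w (y, θ)) - H' (w (y, θ)) * (w (y, θ') - w (y, θ))))
        - ((∫ θ in a..b, S θ * (m (L, θ) * H (w (L, θ))))
          - ∫ θ in a..b, S θ * (m (-L, θ) * H (w (-L, θ)))) := by
  have ex : ∀ y θ h0 e q', (∫ θ' in a..b, κ (y, θ', θ) * m (y, θ') *
        (H (w (y, θ')) - h0 - e * (w (y, θ') - q')))
     = _ := fun y θ h0 e q' => aux_expand a b (fun θ' => κ (y, θ', θ) * m (y, θ'))
      (fun θ' => H (w (y, θ'))) (fun θ' => w (y, θ'))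
      (by fun_prop) (by fun_prop) (by fun_prop) h0 e q'
  set D : ℝ × ℝ → ℝ := fun z =>
    my z * (H (w z) - w z * H' (w z)) + H' (w z) * ny z with hD
  have hDc : Continuous D := by fun_prop
  have e1 : ∀ y ∈ Ioo (-L) L, (∫ θ in a..b, H' (w (y, θ)) * nt (y, θ)) =
      -(∫ θ in a..b, ∫ θ' in a..b, κ (y, θ', θ) * m (y, θ') *
            (H (w (y, θ')) - H (w (y, θ)) - H' (w (y, θ)) * (w (y, θ') - w (y, θ))))
      - ∫ θ in a..b, S θ * D (y, θ) := by
    intro y hy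
    have : (∫ θ in a..b, H' (w (y, θ)) * nt (y, θ)) = ∫ θ in a..b,
      ((-(∫ θ' in a..b, κ (y, θ', θ) * m (y, θ') *
            (H (w (y, θ')) - H (w (y, θ)) - H' (w (y, θ)) * (w (y, θ') - w (y, θ))))
      - S θ * D (y, θ)) + ((∫ θ' in a..b, κ (y, θ', θ) * m (y, θ') * H (w (y, θ')))
        - ∫ θ' in a..b, κ (y, θ, θ') * m (y, θ) * H (w (y, θ)))) := by
      apply intervalIntegral.integral_congr_Ioo_of_le hab
      intro θ hθ
      have h1 := h1 y hy θ hθ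
      have h2 := h2 y hy θ hθ
      simp only [intervalIntegral.integral_mul_const, ex, hD]
      linear_combination H' (w (y, θ)) * h1 + (H (w (y, θ)) - w (y, θ) * H' (w (y, θ))) * h2
    have sw1 := aux_swap a b a b
      (fun z => κ (y, z.2, z.1) * m (y, z.2) * H (w (y, z.2))) (by fun_prop)
    simp only at sw1
    rw [this, intervalIntegral.integral_add, intervalIntegral.integral_sub,
      intervalIntegral.integral_sub, intervalIntegral.integral_neg, sw1]
    · ring
    all_goals exact Continuous.intervalIntegrable (by fun_prop) _ _
  have e2 : (∫ y in (-L)..L, ∫ θ in a..b, S θ * D (y, θ)) =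
      ∫ θ in a..b, (S θ * (m (L, θ) * H (w (L, θ))) - S θ * (m (-L, θ) * H (w (-L, θ)))) := by
    rw [aux_swap (-L) L a b (fun z => S z.2 * D z) (by fun_prop)]
    apply intervalIntegral.integral_congr_Ioo_of_le hab
    intro θ hθ
    simp only [intervalIntegral.integral_const_mul]
    rw [intervalIntegral.integral_eq_sub_of_hasDerivAt_of_le hL
      (f := fun z => m (z, θ) * H (w (z, θ))) (by fun_prop) (fun y hy => h3 y hy θ hθ)
      (Continuous.intervalIntegrable (by fun_prop) _ _)]
    ring
  rw [intervalIntegral.integral_congr_Ioo_of_le hL (fun y hy => e1 y hy),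
    intervalIntegral.integral_sub, intervalIntegral.integral_neg, e2,
    intervalIntegral.integral_sub]
  all_goals exact Continuous.intervalIntegrable (by fun_prop) _ _

lemma aux_ext {X : Type*} [TopologicalSpace X] (s : Set X) (hs : IsCompact s) (f : X → ℝ)
    (hf : Continuous f) (hpos : ∀ x ∈ s, 0 < f x) :
    ∃ M : X → ℝ, Continuous M ∧ (∀ x, 0 < M x) ∧ ∀ x ∈ s, f x = M x := by
  obtain ⟨c, hc, h⟩ := hs.exists_forall_le' hf.continuousOn hpos
  exact ⟨fun x => max (f x) c, by fun_prop, fun x => lt_max_of_lt_right hc,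
    fun x hx => (max_eq_left (h x hx)).symm⟩

lemma aux_ent (M : ℝ → ℝ) (hM : Continuous M) (hpos : ∀ x, 0 < M x) (N N' : ℝ × ℝ → ℝ)
    (hN : Continuous N) (hN' : Continuous N')
    (h : ∀ s x, HasDerivAt (fun s => N (s, x)) (N' (s, x)) s)
    (H : ℝ → ℝ) (hH : ContDiff ℝ 2 H) (a b t : ℝ) :
    HasDerivAt (fun s => ∫ x in a..b, M x * H (N (s, x) / M x))
      (∫ x in a..b, deriv H (N (t, x) / M x) * N' (t, x)) t := by
  have c1 : Continuous H := hH.continuous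
  have c2 : Continuous (deriv H) := hH.continuous_deriv (by norm_num)
  have hne : ∀ x, M x ≠ 0 := fun x => (hpos x).ne'
  refine aux_deriv a b (fun z => M z.2 * H (N z / M z.2)) (fun z => deriv H (N z / M z.2) * N' z)
    ?_ ?_ ?_ t
  · have : Continuous fun z : ℝ × ℝ => N z / M z.2 := hN.div (by fun_prop) (fun z => hne _)
    fun_prop
  · have : Continuous fun z : ℝ × ℝ => N z / M z.2 := hN.div (by fun_prop) (fun z => hne _)
    fun_prop
  · intro s x
    have d1 : HasDerivAt H (deriv H (N (s, x) / M x)) (N (s, x) / M x) :=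
      (hH.differentiable (by norm_num)).differentiableAt.hasDerivAt
    have := (d1.comp s ((h s x).div_const (M x))).const_mul (M x)
    refine this.congr_deriv ?_
    rw [mul_left_comm, mul_div_cancel₀ _ (hne x)]

lemma aux_ent2 (M : ℝ × ℝ → ℝ) (hM : Continuous M) (hpos : ∀ x, 0 < M x) (N N' : ℝ × ℝ × ℝ → ℝ)
    (hN : Continuous N) (hN' : Continuous N')
    (h : ∀ s x, HasDerivAt (fun s => N (s, x)) (N' (s, x)) s)
    (H : ℝ → ℝ) (hH : ContDiff ℝ 2 H) (a b c d t : ℝ) :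
    HasDerivAt (fun s => ∫ y in a..b, ∫ x in c..d, M (y, x) * H (N (s, y, x) / M (y, x)))
      (∫ y in a..b, ∫ x in c..d, deriv H (N (t, y, x) / M (y, x)) * N' (t, y, x)) t := by
  have c1 : Continuous H := hH.continuous
  have c2 : Continuous (deriv H) := hH.continuous_deriv (by norm_num)
  have hne : ∀ x, M x ≠ 0 := fun x => (hpos x).ne'
  have hw : Continuous fun z : ℝ × ℝ × ℝ => N z / M z.2 := hN.div (by fun_prop) (fun z => hne _)
  have q1 : Continuous fun z : ℝ × ℝ × ℝ => M z.2 * H (N z / M z.2) := by fun_prop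
  have q2 : Continuous fun z : ℝ × ℝ × ℝ => deriv H (N z / M z.2) * N' z := by fun_prop
  refine aux_deriv a b (fun z => ∫ x in c..d, M (z.2, x) * H (N (z.1, z.2, x) / M (z.2, x)))
    (fun z => ∫ x in c..d, deriv H (N (z.1, z.2, x) / M (z.2, x)) * N' (z.1, z.2, x))
    ?_ ?_ ?_ t
  · refine intervalIntegral.continuous_parametric_intervalIntegral_of_continuous' ?_ _ _
    exact q1.comp (g := fun z : ℝ × ℝ × ℝ => M z.2 * H (N z / M z.2))
      (f := fun z : (ℝ × ℝ) × ℝ => (z.1.1, z.1.2, z.2)) (by fun_prop)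
  · refine intervalIntegral.continuous_parametric_intervalIntegral_of_continuous' ?_ _ _
    exact q2.comp (g := fun z : ℝ × ℝ × ℝ => deriv H (N z / M z.2) * N' z)
      (f := fun z : (ℝ × ℝ) × ℝ => (z.1.1, z.1.2, z.2)) (by fun_prop)
  · intro s y
    exact aux_ent (fun x => M (y, x)) (by fun_prop) (fun x => hpos _)
      (fun z => N (z.1, y, z.2)) (fun z => N' (z.1, y, z.2)) (by fun_prop) (by fun_prop)
      (fun s x => h s (y, x)) H hH c d s

lemma aux_fst {E : Type*} [NormedAddCommGroup E] [NormedSpace ℝ E] (N : ℝ × E → ℝ)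
    (hN : ContDiff ℝ 1 N) (s : ℝ) (x : E) :
    HasDerivAt (fun s => N (s, x)) (fderiv ℝ N (s, x) (1, 0)) s := by
  have h1 : HasFDerivAt N (fderiv ℝ N (s, x)) (s, x) :=
    (hN.differentiable (by norm_num)).differentiableAt.hasFDerivAt
  exact h1.comp_hasDerivAt s ((hasDerivAt_id s).prodMk (hasDerivAt_const s x))

lemma aux_snd (N : ℝ × ℝ × ℝ → ℝ)
    (hN : ContDiff ℝ 1 N) (s y x : ℝ) :
    HasDerivAt (fun y => N (s, y, x)) (fderiv ℝ N (s, y, x) (0, 1, 0)) y := by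
  have h1 : HasFDerivAt N (fderiv ℝ N (s, y, x)) (s, y, x) :=
    (hN.differentiable (by norm_num)).differentiableAt.hasFDerivAt
  exact h1.comp_hasDerivAt y ((hasDerivAt_const y s).prodMk
    ((hasDerivAt_id y).prodMk (hasDerivAt_const y x)))

lemma aux_fdc {E : Type*} [NormedAddCommGroup E] [NormedSpace ℝ E] (N : E → ℝ)
    (hN : ContDiff ℝ 1 N) (v : E) : Continuous fun z => fderiv ℝ N z v :=
  (hN.continuous_fderiv (by norm_num)).clm_apply continuous_const

/-- **Relative entropy identity** (equality part of Theorem 3.1).  For a classical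
solution `(n, n₊, n₋)` of the CRTM, a positive stationary state `(m, m₊, m₋)`, relative
gaps `ω = n/m`, `ω₊ = n₊/m₊`, `ω₋ = n₋/m₋`, `ω₊L = n(·,L,·)/m(L,·)`,
`ω₋L = n(·,−L,·)/m(−L,·)` and any `H ∈ C²(ℝ)`, the time derivative of the relative
entropy equals the sum of the seven dissipation functionals. -/
theorem crtm_relative_entropy_identity
    (V L : ℝ) (hV : 0 < V) (hL : 0 < L)
    (K : ℝ → ℝ → ℝ → ℝ) (Kp : ℝ → ℝ → ℝ) (Km : ℝ → ℝ → ℝ)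
    (hKc : Continuous (fun p : ℝ × ℝ × ℝ => K p.1 p.2.1 p.2.2))
    (hKpc : Continuous (fun p : ℝ × ℝ => Kp p.1 p.2))
    (hKmc : Continuous (fun p : ℝ × ℝ => Km p.1 p.2))
    (hKnn : ∀ y θ z, 0 ≤ K y θ z)
    (hKpnn : ∀ θ z, 0 ≤ Kp θ z)
    (hKmnn : ∀ θ z, 0 ≤ Km θ z)
    (n : ℝ → ℝ → ℝ → ℝ) (np : ℝ → ℝ → ℝ) (nm : ℝ → ℝ → ℝ)
    (hsol : IsCRTMSolution V L K Kp Km n np nm)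
    (m : ℝ → ℝ → ℝ) (mp : ℝ → ℝ) (mm : ℝ → ℝ)
    (hstat : IsCRTMSolution V L K Kp Km (fun _ => m) (fun _ => mp) (fun _ => mm))
    (hm_pos : ∀ y ∈ Icc (-L) L, ∀ θ ∈ Icc (-π) π, 0 < m y θ)
    (hmp_pos : ∀ θ ∈ Icc (0:ℝ) π, 0 < mp θ)
    (hmm_pos : ∀ θ ∈ Icc (-π) (0:ℝ), 0 < mm θ)
    (H : ℝ → ℝ) (hH : ContDiff ℝ 2 H) :
    ∀ t ≥ (0:ℝ),
      HasDerivAt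
        (fun s => (∫ y in (-L)..L, ∫ θ in (-π)..π, m y θ * H (n s y θ / m y θ))
          + (∫ θ in (0:ℝ)..π, mp θ * H (np s θ / mp θ))
          + (∫ θ in (-π)..(0:ℝ), mm θ * H (nm s θ / mm θ)))
        (D1 L K m H (fun s y θ => n s y θ / m y θ) t
          + D1p Kp mp H (fun s θ => np s θ / mp θ) t
          + D1m Km mm H (fun s θ => nm s θ / mm θ) t
          + D2p V (fun θ => m L θ) H (fun s θ => n s L θ / m L θ)
              (fun s θ => np s θ / mp θ) t
          + D2m V (fun θ => m (-L) θ) H (fun s θ => n s (-L) θ / m (-L) θ)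
              (fun s θ => nm s θ / mm θ) t
          + D3p Kp mp H (fun s θ => np s θ / mp θ) (fun s θ => n s L θ / m L θ) t
          + D3m Km mm H (fun s θ => nm s θ / mm θ) (fun s θ => n s (-L) θ / m (-L) θ) t)
        t := by
  intro t ht
  have c1 : Continuous H := hH.continuous
  have c2 : Continuous (deriv H) := hH.continuous_deriv (by norm_num)
  have hLL : -L ≤ L := by linarith
  have hπ := Real.pi_pos
  have hππ : -π ≤ π := by linarith
  have hπ0 : -π ≤ 0 := by linarith
  have sN := hsol.smooth_n
  have sP := hsol.smooth_np
  have sQ := hsol.smooth_nm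
  have sm := hstat.smooth_n
  have cN := sN.continuous
  have cP := sP.continuous
  have cQ := sQ.continuous
  have cm : Continuous fun z : ℝ × ℝ => m z.1 z.2 :=
    sm.continuous.comp (f := fun z : ℝ × ℝ => ((0:ℝ), z.1, z.2)) (by fun_prop)
  have cmp : Continuous mp :=
    hstat.smooth_np.continuous.comp (f := fun z : ℝ => ((0:ℝ), z)) (by fun_prop)
  have cmm : Continuous mm :=
    hstat.smooth_nm.continuous.comp (f := fun z : ℝ => ((0:ℝ), z)) (by fun_prop)
  obtain ⟨M, cM, pM, eM⟩ := aux_ext (Icc (-L) L ×ˢ Icc (-π) π) (isCompact_Icc.prod isCompact_Icc)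
    (fun z => m z.1 z.2) cm (fun z hz => hm_pos _ hz.1 _ hz.2)
  obtain ⟨Mp, cMp, pMp, eMp⟩ := aux_ext (Icc 0 π) isCompact_Icc mp cmp hmp_pos
  obtain ⟨Mm, cMm, pMm, eMm⟩ := aux_ext (Icc (-π) 0) isCompact_Icc mm cmm hmm_pos
  have eM' : ∀ y ∈ Icc (-L) L, ∀ θ ∈ Icc (-π) π, m y θ = M (y, θ) :=
    fun y hy θ hθ => eM (y, θ) ⟨hy, hθ⟩
  have u1 : uIcc (-L) L = Icc (-L) L := uIcc_of_le hLL
  have u2 : uIcc (-π) π = Icc (-π) π := uIcc_of_le hππ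
  have u3 : uIcc 0 π = Icc 0 π := uIcc_of_le hπ.le
  have u4 : uIcc (-π) 0 = Icc (-π) 0 := uIcc_of_le hπ0
  have s3 : ∀ θ ∈ Icc 0 π, θ ∈ Icc (-π) π := fun θ h => ⟨by linarith [h.1], h.2⟩
  have s4 : ∀ θ ∈ Icc (-π) 0, θ ∈ Icc (-π) π := fun θ h => ⟨h.1, by linarith [h.2]⟩
  have mL : L ∈ Icc (-L) L := ⟨hLL, le_rfl⟩
  have mL' : -L ∈ Icc (-L) L := ⟨le_rfl, hLL⟩
  have cw : Continuous fun z : ℝ × ℝ => n t z.1 z.2 / M z :=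
    (cN.comp (f := fun z : ℝ × ℝ => (t, z.1, z.2)) (by fun_prop)).div cM (fun z => (pM z).ne')
  have cp : Continuous fun z : ℝ => np t z / Mp z :=
    (cP.comp (f := fun z : ℝ => (t, z)) (by fun_prop)).div cMp (fun z => (pMp z).ne')
  have cq : Continuous fun z : ℝ => nm t z / Mm z :=
    (cQ.comp (f := fun z : ℝ => (t, z)) (by fun_prop)).div cMm (fun z => (pMm z).ne')
  have cN' := aux_fdc _ sN (1, 0)
  have cNy := aux_fdc _ sN (0, 1, 0)
  have cmy := aux_fdc _ sm (0, 1, 0)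
  have cP' := aux_fdc _ sP (1, 0)
  have cQ' := aux_fdc _ sQ (1, 0)
  have dN := aux_fst _ sN
  have dP := aux_fst _ sP
  have dQ := aux_fst _ sQ
  have dNy := aux_snd _ sN
  have dmy := aux_snd _ sm
  have ent1 := aux_ent2 M cM pM _ _ cN cN' dN H hH (-L) L (-π) π t
  have ent2 := aux_ent Mp cMp pMp _ _ cP cP' dP H hH 0 π t
  have ent3 := aux_ent Mm cMm pMm _ _ cQ cQ' dQ H hH (-π) 0 t
  -- n = m * w on the box
  have nw : ∀ y ∈ Icc (-L) L, ∀ θ ∈ Icc (-π) π, n t y θ = m y θ * (n t y θ / M (y, θ)) := by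
    intro y hy θ hθ
    rw [eM' y hy θ hθ, mul_div_cancel₀ _ (pM _).ne']
  have npw : ∀ θ ∈ Icc 0 π, np t θ = mp θ * (np t θ / Mp θ) := by
    intro θ hθ
    rw [eMp θ hθ, mul_div_cancel₀ _ (pMp _).ne']
  have nmw : ∀ θ ∈ Icc (-π) 0, nm t θ = mm θ * (nm t θ / Mm θ) := by
    intro θ hθ
    rw [eMm θ hθ, mul_div_cancel₀ _ (pMm _).ne']
  have spP : ∀ θ, (∫ θ' in (-π)..π, Kp θ (θ' - θ))
      = (∫ θ' in (0:ℝ)..π, Kp θ (θ' - θ)) + ∫ θ' in (-π)..0, Kp θ (θ' - θ) := by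
    intro θ
    have c : Continuous fun θ' => Kp θ (θ' - θ) :=
      hKpc.comp (f := fun θ' => (θ, θ' - θ)) (by fun_prop)
    rw [add_comm, intervalIntegral.integral_add_adjacent_intervals]
    all_goals exact c.intervalIntegrable _ _
  have spM : ∀ θ, (∫ θ' in (-π)..π, Km θ (θ' - θ))
      = (∫ θ' in (-π)..0, Km θ (θ' - θ)) + ∫ θ' in (0:ℝ)..π, Km θ (θ' - θ) := by
    intro θ
    have c : Continuous fun θ' => Km θ (θ' - θ) :=
      hKmc.comp (f := fun θ' => (θ, θ' - θ)) (by fun_prop)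
    rw [intervalIntegral.integral_add_adjacent_intervals]
    all_goals exact c.intervalIntegrable _ _
  have intP : ∀ θ, (∫ θ' in (0:ℝ)..π, Kp θ' (θ - θ') * np t θ')
      = ∫ θ' in (0:ℝ)..π, Kp θ' (θ - θ') * mp θ' * (np t θ' / Mp θ') := by
    intro θ
    apply intervalIntegral.integral_congr
    intro θ' h'
    rw [u3] at h'
    simp only
    rw [mul_assoc, ← npw θ' h']
  have intM : ∀ θ, (∫ θ' in (-π)..0, Km θ' (θ - θ') * nm t θ')
      = ∫ θ' in (-π)..0, Km θ' (θ - θ') * mm θ' * (nm t θ' / Mm θ') := by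
    intro θ
    apply intervalIntegral.integral_congr
    intro θ' h'
    rw [u4] at h'
    simp only
    rw [mul_assoc, ← nmw θ' h']
  have I1 := aux_int (a := -π) (b := π) (L := L) hππ hLL
    (fun z => K z.1 z.2.1 (z.2.2 - z.2.1))
    (hKc.comp (f := fun z : ℝ × ℝ × ℝ => (z.1, z.2.1, z.2.2 - z.2.1)) (by fun_prop))
    (fun z => m z.1 z.2) (fun z => n t z.1 z.2 / M z)
    (fun z => fderiv ℝ (fun p : ℝ × ℝ × ℝ => n p.1 p.2.1 p.2.2) (t, z) (1, 0))
    (fun z => fderiv ℝ (fun p : ℝ × ℝ × ℝ => n p.1 p.2.1 p.2.2) (t, z) (0, 1, 0))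
    (fun z => fderiv ℝ (fun p : ℝ × ℝ × ℝ => m p.2.1 p.2.2) (t, z) (0, 1, 0))
    (fun θ => V * sin θ) H (deriv H) (by fun_prop) cm cw
    (cNy.comp (f := fun z : ℝ × ℝ => (t, z)) (by fun_prop))
    (cmy.comp (f := fun z : ℝ × ℝ => (t, z)) (by fun_prop)) c1 c2
    (by
      intro y hy θ hθ
      have h := hsol.interior_eq t ht y hy θ hθ
      have hy' := Ioo_subset_Icc_self hy
      have hθ' := Ioo_subset_Icc_self hθ
      rw [(dN t (y, θ)).deriv, (dNy t y θ).deriv] at h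
      simp only
      rw [← nw y hy' θ hθ', h]
      apply intervalIntegral.integral_congr
      intro θ' h'
      rw [u2] at h'
      simp only
      rw [mul_assoc, ← nw y hy' θ' h'])
    (by
      intro y hy θ hθ
      have h := hstat.interior_eq t ht y hy θ hθ
      rw [(dmy t y θ).deriv] at h
      simpa using h)
    (by
      intro y hy θ hθ
      have hy' := Ioo_subset_Icc_self hy
      have hθ' := Ioo_subset_Icc_self hθ
      have hm := dmy t y θ
      have hn := dNy t y θ
      have hne := (hm_pos y hy' θ hθ').ne'
      have d1 : HasDerivAt H (deriv H (n t y θ / m y θ)) (n t y θ / m y θ) :=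
        (hH.differentiable (by norm_num)).differentiableAt.hasDerivAt
      have h := hm.mul (d1.comp y (hn.div hm hne))
      have e : (fun z => m z θ * H (n t z θ / M (z, θ))) =ᶠ[nhds y]
          (fun z => m z θ * H (n t z θ / m z θ)) := by
        filter_upwards [Ioo_mem_nhds hy.1 hy.2] with z hz
        rw [eM' z (Ioo_subset_Icc_self hz) θ hθ']
      simp only
      refine HasDerivAt.congr_of_eventuallyEq ?_ e
      refine HasDerivAt.congr_deriv h ?_
      simp only [Function.comp, Pi.div_apply]
      rw [← eM' y hy' θ hθ']
      field_simp
      ring)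
  have I2 := aux_wall (a := 0) (b := π) (c := -π) (d := 0) hπ.le hπ0
    (fun z => Kp z.1 (z.2 - z.1))
    (hKpc.comp (f := fun z : ℝ × ℝ => (z.1, z.2 - z.1)) (by fun_prop))
    (fun θ => V * sin θ * m L θ) mp (fun θ => np t θ / Mp θ) (fun θ => n t L θ / M (L, θ))
    (fun z => fderiv ℝ (fun p : ℝ × ℝ => np p.1 p.2) (t, z) (1, 0)) H (deriv H)
    ((by fun_prop : Continuous fun θ => V * sin θ).mul
      (cm.comp (f := fun θ : ℝ => (L, θ)) (by fun_prop))) cmp cp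
    (cw.comp (f := fun θ : ℝ => (L, θ)) (by fun_prop)) c1 c2
    (by
      intro θ hθ
      have h := hsol.top_eq t ht θ hθ
      have hθ' := Ioo_subset_Icc_self hθ
      have e := spP θ
      have e2 := intP θ
      have e3 := nw L mL θ (s3 θ hθ')
      have e4 := npw θ hθ'
      rw [(dP t θ).deriv, e, e2] at h
      simp only
      rw [mul_assoc (V * sin θ), ← e3, ← e4]
      linarith)
    (by
      intro θ hθ
      have h := hstat.top_eq t ht θ hθ
      have e := spP θ
      simp only [deriv_const, zero_add] at h
      rw [e] at h
      simp only
      linarith)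
    (by
      intro θ hθ
      have h := hsol.bc_top t ht θ hθ
      have hθ' := Ioo_subset_Icc_self hθ
      have e3 := nw L mL θ (s4 θ hθ')
      have e2 := intP θ
      rw [e2] at h
      simp only
      rw [mul_assoc (V * sin θ), ← e3]
      exact h)
    (by
      intro θ hθ
      exact hstat.bc_top t ht θ hθ)
  have I3 := aux_wall (a := -π) (b := 0) (c := 0) (d := π) hπ0 hπ.le
    (fun z => Km z.1 (z.2 - z.1))
    (hKmc.comp (f := fun z : ℝ × ℝ => (z.1, z.2 - z.1)) (by fun_prop))
    (fun θ => -(V * sin θ * m (-L) θ)) mm (fun θ => nm t θ / Mm θ)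
    (fun θ => n t (-L) θ / M (-L, θ))
    (fun z => fderiv ℝ (fun p : ℝ × ℝ => nm p.1 p.2) (t, z) (1, 0)) H (deriv H)
    ((by fun_prop : Continuous fun θ => V * sin θ).mul
      (cm.comp (f := fun θ : ℝ => (-L, θ)) (by fun_prop))).neg cmm cq
    (cw.comp (f := fun θ : ℝ => (-L, θ)) (by fun_prop)) c1 c2
    (by
      intro θ hθ
      have h := hsol.bot_eq t ht θ hθ
      have hθ' := Ioo_subset_Icc_self hθ
      have e := spM θ
      have e2 := intM θ
      have e3 := nw (-L) mL' θ (s4 θ hθ')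
      have e4 := nmw θ hθ'
      rw [(dQ t θ).deriv, e, e2] at h
      simp only
      rw [neg_mul, mul_assoc (V * sin θ), ← e3, ← e4]
      linarith)
    (by
      intro θ hθ
      have h := hstat.bot_eq t ht θ hθ
      have e := spM θ
      simp only [deriv_const, zero_add] at h
      rw [e] at h
      simp only
      linarith)
    (by
      intro θ hθ
      have h := hsol.bc_bot t ht θ hθ
      have hθ' := Ioo_subset_Icc_self hθ
      have e3 := nw (-L) mL' θ (s3 θ hθ')
      have e2 := intM θ
      rw [e2] at h
      simp only
      rw [neg_mul, neg_neg, mul_assoc (V * sin θ), ← e3]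
      exact h)
    (by
      intro θ hθ
      simpa using hstat.bc_bot t ht θ hθ)
  have key := (ent1.add ent2).add ent3
  have wM : ∀ y ∈ Icc (-L) L, ∀ θ ∈ Icc (-π) π, n t y θ / m y θ = n t y θ / M (y, θ) :=
    fun y hy θ hθ => by rw [eM' y hy θ hθ]
  have wp : ∀ θ ∈ Icc 0 π, np t θ / mp θ = np t θ / Mp θ := fun θ hθ => by rw [eMp θ hθ]
  have wm : ∀ θ ∈ Icc (-π) 0, nm t θ / mm θ = nm t θ / Mm θ := fun θ hθ => by rw [eMm θ hθ]
  refine HasDerivAt.congr_deriv (HasDerivAt.congr_of_eventuallyEq key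
    (Filter.Eventually.of_forall ?_)) ?_
  · intro s
    simp only [Pi.add_apply]
    congr 1
    · congr 1
      · refine intervalIntegral.integral_congr fun y hy => intervalIntegral.integral_congr fun θ hθ => ?_
        rw [u1] at hy
        rw [u2] at hθ
        beta_reduce
        rw [eM' y hy θ hθ]
      · refine intervalIntegral.integral_congr fun θ hθ => ?_
        rw [u3] at hθ
        beta_reduce
        rw [eMp θ hθ]
    · refine intervalIntegral.integral_congr fun θ hθ => ?_
      rw [u4] at hθ
      beta_reduce
      rw [eMm θ hθ]
  · refine (congrArg₂ (· + ·) (congrArg₂ (· + ·) I1 I2) I3).trans ?_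
    have E1 : D1 L K m H (fun s y θ => n s y θ / m y θ) t
        = D1 L K m H (fun s y θ => n s y θ / M (y, θ)) t := by
      unfold D1
      refine congrArg Neg.neg (intervalIntegral.integral_congr fun y hy =>
        intervalIntegral.integral_congr fun θ hθ => intervalIntegral.integral_congr fun θ' hθ' => ?_)
      rw [u1] at hy
      rw [u2] at hθ hθ'
      simp only [wM y hy θ hθ, wM y hy θ' hθ']
    have E2 : D1p Kp mp H (fun s θ => np s θ / mp θ) t
        = D1p Kp mp H (fun s θ => np s θ / Mp θ) t := by
      unfold D1p
      refine congrArg Neg.neg (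
        intervalIntegral.integral_congr fun θ hθ => intervalIntegral.integral_congr fun θ' hθ' => ?_)
      rw [u3] at hθ hθ'
      simp only [wp θ hθ, wp θ' hθ']
    have E3 : D1m Km mm H (fun s θ => nm s θ / mm θ) t
        = D1m Km mm H (fun s θ => nm s θ / Mm θ) t := by
      unfold D1m
      refine congrArg Neg.neg (
        intervalIntegral.integral_congr fun θ hθ => intervalIntegral.integral_congr fun θ' hθ' => ?_)
      rw [u4] at hθ hθ'
      simp only [wm θ hθ, wm θ' hθ']
    have E4 : D2p V (fun θ => m L θ) H (fun s θ => n s L θ / m L θ) (fun s θ => np s θ / mp θ) t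
        = D2p V (fun θ => m L θ) H (fun s θ => n s L θ / M (L, θ)) (fun s θ => np s θ / Mp θ) t := by
      unfold D2p
      refine congrArg Neg.neg (intervalIntegral.integral_congr fun θ hθ => ?_)
      rw [u3] at hθ
      simp only [wp θ hθ, wM L mL θ (s3 θ hθ)]
    have E5 : D2m V (fun θ => m (-L) θ) H (fun s θ => n s (-L) θ / m (-L) θ)
          (fun s θ => nm s θ / mm θ) t
        = -∫ θ in (-π)..0, -(V * sin θ * m (-L) θ) *
                  (H (n t (-L) θ / M (-L, θ)) - H (nm t θ / Mm θ) -
                    deriv H (nm t θ / Mm θ) * (n t (-L) θ / M (-L, θ) - nm t θ / Mm θ)) := by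
      unfold D2m
      rw [← intervalIntegral.integral_neg]
      refine intervalIntegral.integral_congr fun θ hθ => ?_
      rw [u4] at hθ
      simp only [wm θ hθ, wM (-L) mL' θ (s4 θ hθ), neg_mul, neg_neg]
    have E6 : D3p Kp mp H (fun s θ => np s θ / mp θ) (fun s θ => n s L θ / m L θ) t
        = D3p Kp mp H (fun s θ => np s θ / Mp θ) (fun s θ => n s L θ / M (L, θ)) t := by
      unfold D3p
      refine congrArg Neg.neg (
        intervalIntegral.integral_congr fun θ hθ => intervalIntegral.integral_congr fun θ' hθ' => ?_)
      rw [u4] at hθ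
      rw [u3] at hθ'
      simp only [wp θ' hθ', wM L mL θ (s4 θ hθ)]
    have E7 : D3m Km mm H (fun s θ => nm s θ / mm θ) (fun s θ => n s (-L) θ / m (-L) θ) t
        = D3m Km mm H (fun s θ => nm s θ / Mm θ) (fun s θ => n s (-L) θ / M (-L, θ)) t := by
      unfold D3m
      refine congrArg Neg.neg (
        intervalIntegral.integral_congr fun θ hθ => intervalIntegral.integral_congr fun θ' hθ' => ?_)
      rw [u3] at hθ
      rw [u4] at hθ'
      simp only [wm θ' hθ', wM (-L) mL' θ (s3 θ hθ)]
    have B : ∀ l : ℝ, (∫ θ in (-π)..π, V * sin θ * (m l θ * H (n t l θ / M (l, θ))))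
        = (∫ θ in (-π)..0, V * sin θ * m l θ * H (n t l θ / M (l, θ)))
          + ∫ θ in (0:ℝ)..π, V * sin θ * m l θ * H (n t l θ / M (l, θ)) := by
      intro l
      have a1 : Continuous fun θ => m l θ := cm.comp (f := fun θ : ℝ => (l, θ)) (by fun_prop)
      have a2 : Continuous fun θ => n t l θ / M (l, θ) :=
        cw.comp (f := fun θ : ℝ => (l, θ)) (by fun_prop)
      rw [intervalIntegral.integral_add_adjacent_intervals]
      · simp only [mul_assoc]
      all_goals exact Continuous.intervalIntegrable (by fun_prop) _ _
    rw [E1, E2, E3, E4, E5, E6, E7]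
    simp only [D1, D1p, D1m, D2p, D3p, D3m, B]
    simp only [neg_mul, intervalIntegral.integral_neg]
    ring
end
end

section
/- Upper-boundary entropy production identity (equation (3.22) in the proof of Theorem 3.1). Let n₊ : [0,∞)×[0,π] → ℝ be C¹ and n(t,L,·) continuous on [−π,π] satisfying equation (ii) for θ ∈ (0,π) and boundary condition (v) for θ ∈ (−π,0); let m₊ : [0,π] → (0,∞) and m(L,·) : [−π,π] → (0,∞) be continuous and satisfy the stationary versions of (ii) and (v), i.e. k₊(θ) m₊(θ) = ∫_0^{π} K₊(θ',θ−θ') m₊(θ') dθ' + V sin θ · m(L,θ) for θ ∈ (0,π) and −V sin θ · m(L,θ) = ∫_0^{π} K₊(θ',θ−θ') m₊(θ') dθ' for θ ∈ (−π,0). Set ω₊ = n₊/m₊ and ω₊L(t,θ) = n(t,L,θ)/m(L,θ), and let H ∈ C²(ℝ). Then d/dt ∫_0^{π} m₊(θ) H(ω₊(t,θ)) dθ = D1₊(t) + D2₊(t) + D3₊(t) + ∫_{−π}^{π} V sin θ · m(L,θ) H(ω₊L(t,θ)) dθ, where D1₊(t) = −∫_0^{π}∫_0^{π} K₊(θ',θ−θ')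 m₊(θ') [H(ω₊(t,θ')) − H(ω₊(t,θ)) − H'(ω₊(t,θ))(ω₊(t,θ') − ω₊(t,θ))] dθ' dθ, D2₊(t) = −∫_0^{π} V sin θ · m(L,θ) [H(ω₊L(t,θ)) − H(ω₊(t,θ)) − H'(ω₊(t,θ))(ω₊L(t,θ) − ω₊(t,θ))] dθ, and D3₊(t) = −∫_{−π}^{0}∫_0^{π} K₊(θ',θ−θ') m₊(θ') [H(ω₊(t,θ')) − H(ω₊L(t,θ)) − H'(ω₊L(t,θ))(ω₊(t,θ') − ω₊L(t,θ))] dθ' dθ. -/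
open MeasureTheory Real Set

noncomputable section

theorem aux_congr_Ioo {f g : ℝ → ℝ} {a b : ℝ} (hab : a ≤ b) (h : ∀ x ∈ Ioo a b, f x = g x) :
    ∫ x in a..b, f x = ∫ x in a..b, g x := by
  rw [intervalIntegral.integral_of_le hab, intervalIntegral.integral_of_le hab,
    integral_Ioc_eq_integral_Ioo, integral_Ioc_eq_integral_Ioo]
  exact setIntegral_congr_fun measurableSet_Ioo h

theorem aux_deriv_s7 (np : ℝ → ℝ → ℝ) (hnp : ContDiff ℝ 1 (fun p : ℝ × ℝ => np p.1 p.2))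
    (M : ℝ → ℝ) (hM : Continuous M) (hMpos : ∀ θ, 0 < M θ)
    (H : ℝ → ℝ) (hH : ContDiff ℝ 2 H) (t : ℝ) :
    HasDerivAt (fun s => ∫ θ in (0:ℝ)..π, M θ * H (np s θ / M θ))
      (∫ θ in (0:ℝ)..π, deriv H (np t θ / M θ) * deriv (fun s => np s θ) t) t := by
  have hne : ∀ θ, M θ ≠ 0 := fun θ => (hMpos θ).ne'
  have hH1 : ContDiff ℝ 1 H := hH.of_le (by norm_num)
  have hHc : Continuous H := hH.continuous
  have hdH : Continuous (deriv H) := hH1.continuous_deriv le_rfl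
  have hnpc : Continuous (fun p : ℝ × ℝ => np p.1 p.2) := hnp.continuous
  have hder : ∀ s θ, HasDerivAt (fun s => np s θ)
      (fderiv ℝ (fun p : ℝ × ℝ => np p.1 p.2) (s, θ) (1, 0)) s := by
    intro s θ
    have h1 : HasFDerivAt (fun p : ℝ × ℝ => np p.1 p.2)
      (fderiv ℝ (fun p : ℝ × ℝ => np p.1 p.2) (s, θ)) (s, θ) :=
      ((hnp.differentiable (by norm_num)) (s, θ)).hasFDerivAt
    have h2 : HasDerivAt (fun s : ℝ => (s, θ)) ((1:ℝ), (0:ℝ)) s :=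
      (hasDerivAt_id s).prodMk (hasDerivAt_const s θ)
    exact h1.comp_hasDerivAt s h2
  have hdeq : ∀ s θ, deriv (fun s => np s θ) s
      = fderiv ℝ (fun p : ℝ × ℝ => np p.1 p.2) (s, θ) (1, 0) := fun s θ => (hder s θ).deriv
  have hdc : Continuous (fun p : ℝ × ℝ => deriv (fun s => np s p.2) p.1) := by
    simp_rw [hdeq]
    exact (hnp.continuous_fderiv (by norm_num)).clm_apply continuous_const
  have hw : Continuous (fun p : ℝ × ℝ => np p.1 p.2 / M p.2) :=
    hnpc.div (hM.comp continuous_snd) (fun p => hne _)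
  have hF' : Continuous (fun p : ℝ × ℝ =>
      deriv H (np p.1 p.2 / M p.2) * deriv (fun s => np s p.2) p.1) :=
    (hdH.comp hw).mul hdc
  have hF : Continuous (fun p : ℝ × ℝ => M p.2 * H (np p.1 p.2 / M p.2)) :=
    (hM.comp continuous_snd).mul (hHc.comp hw)
  obtain ⟨C, hC⟩ := ((isCompact_Icc (a := t - 1) (b := t + 1)).prod
    (isCompact_Icc (a := (0:ℝ)) (b := π))).exists_bound_of_continuousOn hF'.continuousOn
  refine (intervalIntegral.hasDerivAt_integral_of_dominated_loc_of_deriv_le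
    (F := fun s θ => M θ * H (np s θ / M θ))
    (F' := fun s θ => deriv H (np s θ / M θ) * deriv (fun s => np s θ) s)
    (bound := fun _ => C) (s := Icc (t - 1) (t + 1))
    (Icc_mem_nhds (by linarith) (by linarith)) ?_ ?_ ?_ ?_ ?_ ?_).2
  · exact Filter.Eventually.of_forall fun s =>
      (hF.comp (Continuous.prodMk_right s)).aestronglyMeasurable
  · exact (hF.comp (Continuous.prodMk_right t)).intervalIntegrable _ _
  · exact (hF'.comp (Continuous.prodMk_right t)).aestronglyMeasurable
  · refine Filter.Eventually.of_forall fun θ hθ s hs => ?_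
    rw [uIoc_of_le pi_pos.le] at hθ
    exact hC (s, θ) ⟨hs, ⟨hθ.1.le, hθ.2⟩⟩
  · exact intervalIntegrable_const
  · refine Filter.Eventually.of_forall fun θ hθ s hs => ?_
    have h1 : HasDerivAt H (deriv H (np s θ / M θ)) (np s θ / M θ) :=
      ((hH1.differentiable (by norm_num)) _).hasDerivAt
    have h2 := (hder s θ).div_const (M θ)
    rw [← hdeq] at h2
    have h3 := (h1.comp s h2).const_mul (M θ)
    refine h3.congr_deriv ?_
    have := hne θ
    field_simp

theorem aux_core (V : ℝ) (Kp : ℝ → ℝ → ℝ)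
    (hKpc : Continuous (fun p : ℝ × ℝ => Kp p.1 p.2))
    (n N d m mL H : ℝ → ℝ) (hn : Continuous n) (hN : Continuous N)
    (hm : Continuous m) (hmL : Continuous mL) (hmpos : ∀ θ, 0 < m θ) (hmLpos : ∀ θ, 0 < mL θ)
    (hH : ContDiff ℝ 2 H)
    (heq : ∀ θ ∈ Ioo (0:ℝ) π,
      d θ + (∫ θ' in (-π)..π, Kp θ (θ' - θ)) * n θ
        = (∫ θ' in (0:ℝ)..π, Kp θ' (θ - θ') * n θ') + V * sin θ * N θ)
    (hbc : ∀ θ ∈ Ioo (-π) (0:ℝ),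
      -(V * sin θ * N θ) = ∫ θ' in (0:ℝ)..π, Kp θ' (θ - θ') * n θ')
    (hmeq : ∀ θ ∈ Ioo (0:ℝ) π,
      (∫ θ' in (-π)..π, Kp θ (θ' - θ)) * m θ
        = (∫ θ' in (0:ℝ)..π, Kp θ' (θ - θ') * m θ') + V * sin θ * mL θ)
    (hmbc : ∀ θ ∈ Ioo (-π) (0:ℝ),
      -(V * sin θ * mL θ) = ∫ θ' in (0:ℝ)..π, Kp θ' (θ - θ') * m θ') :
    ∫ θ in (0:ℝ)..π, deriv H (n θ / m θ) * d θ =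
      (-∫ θ in (0:ℝ)..π, ∫ θ' in (0:ℝ)..π, Kp θ' (θ - θ') * m θ' *
        (H (n θ' / m θ') - H (n θ / m θ) - deriv H (n θ / m θ) * (n θ' / m θ' - n θ / m θ)))
      + (-∫ θ in (0:ℝ)..π, V * sin θ * mL θ *
        (H (N θ / mL θ) - H (n θ / m θ) - deriv H (n θ / m θ) * (N θ / mL θ - n θ / m θ)))
      + (-∫ θ in (-π)..(0:ℝ), ∫ θ' in (0:ℝ)..π, Kp θ' (θ - θ') * m θ' *
        (H (n θ' / m θ') - H (N θ / mL θ) - deriv H (N θ / mL θ) * (n θ' / m θ' - N θ / mL θ)))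
      + ∫ θ in (-π)..π, V * sin θ * mL θ * H (N θ / mL θ) := by
  have hne : ∀ θ, m θ ≠ 0 := fun θ => (hmpos θ).ne'
  have hneL : ∀ θ, mL θ ≠ 0 := fun θ => (hmLpos θ).ne'
  have hH1 : ContDiff ℝ 1 H := hH.of_le (by norm_num)
  have hHc : Continuous H := hH.continuous
  have hdH : Continuous (deriv H) := hH1.continuous_deriv le_rfl
  obtain ⟨w, hw⟩ : ∃ w : ℝ → ℝ, w = fun θ => n θ / m θ := ⟨_, rfl⟩
  obtain ⟨W, hW⟩ : ∃ W : ℝ → ℝ, W = fun θ => N θ / mL θ := ⟨_, rfl⟩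
  have hwc : Continuous w := by rw [hw]; exact hn.div hm hne
  have hWc : Continuous W := by rw [hW]; exact hN.div hmL hneL
  have hw' : ∀ θ, n θ / m θ = w θ := fun θ => by rw [hw]
  have hW' : ∀ θ, N θ / mL θ = W θ := fun θ => by rw [hW]
  have hnw : ∀ θ, n θ = m θ * w θ := fun θ => by rw [← hw']; field_simp [hne θ]
  have hNW : ∀ θ, N θ = mL θ * W θ := fun θ => by rw [← hW']; field_simp [hneL θ]
  simp only [hw', hW']
  have hK2 : Continuous (fun p : ℝ × ℝ => Kp p.2 (p.1 - p.2)) :=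
    hKpc.comp (continuous_snd.prodMk (continuous_fst.sub continuous_snd))
  have hK1 : ∀ θ, Continuous (fun θ' => Kp θ' (θ - θ')) := fun θ =>
    hK2.comp (Continuous.prodMk_right θ)
  have hpar : ∀ f : ℝ → ℝ, Continuous f →
      Continuous (fun θ => ∫ θ' in (0:ℝ)..π, Kp θ' (θ - θ') * f θ') := by
    intro f hf
    refine intervalIntegral.continuous_parametric_intervalIntegral_of_continuous' ?_ _ _
    exact hK2.mul (hf.comp continuous_snd)
  obtain ⟨P, hP⟩ : ∃ P : ℝ → ℝ, P = fun θ => ∫ θ' in (0:ℝ)..π, Kp θ' (θ - θ') * m θ' := ⟨_, rfl⟩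
  obtain ⟨Q, hQ⟩ : ∃ Q : ℝ → ℝ, Q = fun θ => ∫ θ' in (0:ℝ)..π, Kp θ' (θ - θ') * n θ' := ⟨_, rfl⟩
  obtain ⟨R, hR⟩ : ∃ R : ℝ → ℝ, R = fun θ => ∫ θ' in (0:ℝ)..π, Kp θ' (θ - θ') * (m θ' * H (w θ')) :=
    ⟨_, rfl⟩
  have hPc : Continuous P := by rw [hP]; exact hpar _ hm
  have hQc : Continuous Q := by rw [hQ]; exact hpar _ hn
  have hRc : Continuous R := by rw [hR]; exact hpar _ (by fun_prop)
  have hP' : ∀ θ, ∫ θ' in (0:ℝ)..π, Kp θ' (θ - θ') * m θ' = P θ := fun θ => by rw [hP]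
  have hQ' : ∀ θ, ∫ θ' in (0:ℝ)..π, Kp θ' (θ - θ') * n θ' = Q θ := fun θ => by rw [hQ]
  simp only [hP', hQ'] at heq hbc hmeq hmbc
  have inner : ∀ θ u b c, ∫ θ' in (0:ℝ)..π, Kp θ' (θ - θ') * m θ' * (H (w θ') - b - c * (w θ' - u))
      = R θ - b * P θ - c * (Q θ - u * P θ) := by
    intro θ u b c
    have hk := hK1 θ
    rw [hR, hQ, hP]
    have e : ∀ θ', Kp θ' (θ - θ') * m θ' * (H (w θ') - b - c * (w θ' - u))
        = Kp θ' (θ - θ') * (m θ' * H (w θ')) + (c * u - b) * (Kp θ' (θ - θ') * m θ')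
          - c * (Kp θ' (θ - θ') * n θ') := by
      intro θ'; rw [hnw θ']; ring
    simp only [e]
    rw [intervalIntegral.integral_sub, intervalIntegral.integral_add,
      intervalIntegral.integral_const_mul, intervalIntegral.integral_const_mul]
    · ring
    all_goals exact Continuous.intervalIntegrable (by fun_prop) _ _
  simp only [inner]
  -- Fubini
  have fub : ∫ θ in (-π)..π, R θ
      = ∫ θ in (0:ℝ)..π, (∫ θ' in (-π)..π, Kp θ (θ' - θ)) * (m θ * H (w θ)) := by
    rw [hR, intervalIntegral_intervalIntegral_swap]
    · simp only [intervalIntegral.integral_mul_const]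
    · have hc : Continuous (Function.uncurry fun θ θ' => Kp θ' (θ - θ') * (m θ' * H (w θ'))) :=
        hK2.mul ((by fun_prop : Continuous fun x => m x * H (w x)).comp continuous_snd)
      refine (hc.continuousOn.integrableOn_compact
        ((isCompact_uIcc (a := -π) (b := π)).prod (isCompact_uIcc (a := (0:ℝ)) (b := π)))).mono_set
        (prod_mono uIoc_subset_uIcc uIoc_subset_uIcc)
  have fub2 : ∫ θ in (-π)..π, R θ
      = ∫ θ in (0:ℝ)..π, (P θ + V * sin θ * mL θ) * H (w θ) := by
    rw [fub]
    refine aux_congr_Ioo pi_pos.le fun θ hθ => ?_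
    rw [← hmeq θ hθ]; ring
  have eL : ∫ θ in (0:ℝ)..π, deriv H (w θ) * d θ
      = ∫ θ in (0:ℝ)..π, deriv H (w θ) * (Q θ - w θ * P θ + V * sin θ * mL θ * (W θ - w θ)) := by
    refine aux_congr_Ioo pi_pos.le fun θ hθ => ?_
    have h1 := heq θ hθ
    have h2 := hmeq θ hθ
    rw [hnw, hNW] at h1
    congr 1
    linear_combination h1 - w θ * h2
  have e3 : ∫ θ in (-π)..(0:ℝ), (R θ - H (W θ) * P θ - deriv H (W θ) * (Q θ - W θ * P θ))
      = ∫ θ in (-π)..(0:ℝ), (R θ + V * sin θ * mL θ * H (W θ)) := by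
    refine aux_congr_Ioo (by linarith [pi_pos]) fun θ hθ => ?_
    have h1 := hbc θ hθ
    have h2 := hmbc θ hθ
    rw [hNW] at h1
    rw [← h1, ← h2]; ring
  have ii : ∀ f : ℝ → ℝ, Continuous f → ∀ a b, IntervalIntegrable f volume a b :=
    fun f hf a b => hf.intervalIntegrable a b
  have s1 := intervalIntegral.integral_add_adjacent_intervals
    (ii R hRc (-π) 0) (ii R hRc 0 π)
  have hSc : Continuous fun θ => V * sin θ * mL θ * H (W θ) := by fun_prop
  have s2 := intervalIntegral.integral_add_adjacent_intervals
    (ii _ hSc (-π) 0) (ii _ hSc 0 π)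
  rw [e3, eL, ← s2, intervalIntegral.integral_add (ii _ hRc _ _) (ii _ hSc _ _)]
  have key : ∫ θ in (0:ℝ)..π, deriv H (w θ) * (Q θ - w θ * P θ + V * sin θ * mL θ * (W θ - w θ))
      = (-∫ θ in (0:ℝ)..π, (R θ - H (w θ) * P θ - deriv H (w θ) * (Q θ - w θ * P θ)))
      + (-∫ θ in (0:ℝ)..π, V * sin θ * mL θ * (H (W θ) - H (w θ) - deriv H (w θ) * (W θ - w θ)))
      + (∫ θ in (0:ℝ)..π, R θ) - (∫ θ in (0:ℝ)..π, (P θ + V * sin θ * mL θ) * H (w θ))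
      + ∫ θ in (0:ℝ)..π, V * sin θ * mL θ * H (W θ) := by
    rw [← intervalIntegral.integral_neg, ← intervalIntegral.integral_neg,
      ← intervalIntegral.integral_add, ← intervalIntegral.integral_add,
      ← intervalIntegral.integral_sub, ← intervalIntegral.integral_add]
    · congr 1; funext θ; ring
    all_goals exact Continuous.intervalIntegrable (by fun_prop) _ _
  rw [key]
  linarith

theorem aux_ext_s7 {a b : ℝ} (hab : a ≤ b) (f : ℝ → ℝ) (hf : ContinuousOn f (Icc a b)) :
    ∃ g : ℝ → ℝ, Continuous g ∧ (∀ x ∈ Icc a b, g x = f x) ∧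
      ∀ x, ∃ y ∈ Icc a b, g x = f y := by
  refine ⟨fun x => f (projIcc a b hab x), ?_, ?_, ?_⟩
  · exact hf.restrict.comp continuous_projIcc
  · intro x hx
    simp only [projIcc_of_mem hab hx]
  · intro x
    exact ⟨_, (projIcc a b hab x).2, rfl⟩

/-- **Upper-boundary entropy production identity** (equation (3.22) in the proof of
Theorem 3.1).  With `ω₊ = n₊/m₊` and `ω₊L = n(·,L,·)/m(L,·)`,
`d/dt ∫_0^{π} m₊ H(ω₊) dθ
   = D1₊(t) + D2₊(t) + D3₊(t) + ∫_{−π}^{π} V sin θ m(L,θ) H(ω₊L) dθ`. -/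
theorem crtm_upper_boundary_entropy_production
    (V L : ℝ) (hV : 0 < V) (hL : 0 < L)
    (Kp : ℝ → ℝ → ℝ)
    (hKpc : Continuous (fun p : ℝ × ℝ => Kp p.1 p.2))
    (hKpnn : ∀ θ z, 0 ≤ Kp θ z)
    (np : ℝ → ℝ → ℝ) (nL : ℝ → ℝ → ℝ)
    (hnp : ContDiff ℝ 1 (fun p : ℝ × ℝ => np p.1 p.2))
    (hnL : ContinuousOn (fun p : ℝ × ℝ => nL p.1 p.2) (Ici 0 ×ˢ Icc (-π) π))
    (heq : ∀ t ≥ (0:ℝ), ∀ θ ∈ Ioo (0:ℝ) π,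
      deriv (fun s => np s θ) t + (∫ θ' in (-π)..π, Kp θ (θ' - θ)) * np t θ
        = (∫ θ' in (0:ℝ)..π, Kp θ' (θ - θ') * np t θ') + V * sin θ * nL t θ)
    (hbc : ∀ t ≥ (0:ℝ), ∀ θ ∈ Ioo (-π) (0:ℝ),
      -(V * sin θ * nL t θ) = ∫ θ' in (0:ℝ)..π, Kp θ' (θ - θ') * np t θ')
    (mp : ℝ → ℝ) (mL : ℝ → ℝ)
    (hmp : ContinuousOn mp (Icc 0 π)) (hmL : ContinuousOn mL (Icc (-π) π))
    (hmp_pos : ∀ θ ∈ Icc (0:ℝ) π, 0 < mp θ)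
    (hmL_pos : ∀ θ ∈ Icc (-π) π, 0 < mL θ)
    (hmeq : ∀ θ ∈ Ioo (0:ℝ) π,
      (∫ θ' in (-π)..π, Kp θ (θ' - θ)) * mp θ
        = (∫ θ' in (0:ℝ)..π, Kp θ' (θ - θ') * mp θ') + V * sin θ * mL θ)
    (hmbc : ∀ θ ∈ Ioo (-π) (0:ℝ),
      -(V * sin θ * mL θ) = ∫ θ' in (0:ℝ)..π, Kp θ' (θ - θ') * mp θ')
    (H : ℝ → ℝ) (hH : ContDiff ℝ 2 H) :
    ∀ t ≥ (0:ℝ),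
      HasDerivAt (fun s => ∫ θ in (0:ℝ)..π, mp θ * H (np s θ / mp θ))
        (D1p Kp mp H (fun s θ => np s θ / mp θ) t
          + D2p V mL H (fun s θ => nL s θ / mL θ) (fun s θ => np s θ / mp θ) t
          + D3p Kp mp H (fun s θ => np s θ / mp θ) (fun s θ => nL s θ / mL θ) t
          + ∫ θ in (-π)..π, V * sin θ * mL θ * H (nL t θ / mL θ)) t := by
  intro t ht
  have hpi := pi_pos
  obtain ⟨M, hMc, hMe, hMr⟩ := aux_ext_s7 hpi.le mp hmp
  obtain ⟨ML, hMLc, hMLe, hMLr⟩ := aux_ext_s7 (by linarith : -π ≤ π) mL hmL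
  have hNc : ContinuousOn (nL t) (Icc (-π) π) := by
    refine hnL.comp (f := fun θ => (t, θ)) (Continuous.prodMk_right t).continuousOn ?_
    intro θ hθ
    exact ⟨ht, hθ⟩
  obtain ⟨N, hNc, hNe, -⟩ := aux_ext_s7 (by linarith : -π ≤ π) (nL t) hNc
  have hMpos : ∀ θ, 0 < M θ := fun θ => by
    obtain ⟨y, hy, e⟩ := hMr θ
    rw [e]; exact hmp_pos y hy
  have hMLpos : ∀ θ, 0 < ML θ := fun θ => by
    obtain ⟨y, hy, e⟩ := hMLr θ
    rw [e]; exact hmL_pos y hy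
  have hu : uIcc (0:ℝ) π = Icc 0 π := uIcc_of_le hpi.le
  have hu2 : uIcc (-π) 0 = Icc (-π) 0 := uIcc_of_le (by linarith)
  have hu3 : uIcc (-π) π = Icc (-π) π := uIcc_of_le (by linarith)
  have sub1 : ∀ θ ∈ Icc (0:ℝ) π, θ ∈ Icc (-π) π := fun θ h => ⟨by linarith [h.1], h.2⟩
  have sub2 : ∀ θ ∈ Icc (-π) 0, θ ∈ Icc (-π) π := fun θ h => ⟨h.1, by linarith [h.2]⟩
  have hPm : ∀ θ, ∫ θ' in (0:ℝ)..π, Kp θ' (θ - θ') * M θ'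
      = ∫ θ' in (0:ℝ)..π, Kp θ' (θ - θ') * mp θ' := fun θ =>
    intervalIntegral.integral_congr fun θ' h => by
      rw [hu] at h
      simp only [hMe θ' h]
  have hcore := aux_core V Kp hKpc (np t) N (fun θ => deriv (fun s => np s θ) t) M ML H
    (hnp.continuous.comp (Continuous.prodMk_right t)) hNc hMc hMLc hMpos hMLpos hH
    (fun θ h => by
      rw [hNe θ (sub1 θ (Ioo_subset_Icc_self h))]; exact heq t ht θ h)
    (fun θ h => by
      rw [hNe θ (sub2 θ (Ioo_subset_Icc_self h))]; exact hbc t ht θ h)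
    (fun θ h => by
      rw [hPm, hMe θ (Ioo_subset_Icc_self h), hMLe θ (sub1 θ (Ioo_subset_Icc_self h))]
      exact hmeq θ h)
    (fun θ h => by
      rw [hPm, hMLe θ (sub2 θ (Ioo_subset_Icc_self h))]
      exact hmbc θ h)
  have hd := aux_deriv_s7 np hnp M hMc hMpos H hH t
  rw [hcore] at hd
  have hfun : (fun s => ∫ θ in (0:ℝ)..π, mp θ * H (np s θ / mp θ))
      = fun s => ∫ θ in (0:ℝ)..π, M θ * H (np s θ / M θ) := by
    funext s
    refine intervalIntegral.integral_congr fun θ h => ?_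
    rw [hu] at h
    simp only [hMe θ h]
  rw [hfun]
  refine hd.congr_deriv ?_
  unfold D1p D2p D3p
  congr 1
  · congr 1
    · congr 1
      · congr 1
        refine intervalIntegral.integral_congr fun θ h => ?_
        refine intervalIntegral.integral_congr fun θ' h' => ?_
        rw [hu] at h h'
        simp only [hMe θ h, hMe θ' h']
      · congr 1
        refine intervalIntegral.integral_congr fun θ h => ?_
        rw [hu] at h
        simp only [hMe θ h, hMLe θ (sub1 θ h), hNe θ (sub1 θ h)]
    · congr 1
      refine intervalIntegral.integral_congr fun θ h => ?_
      refine intervalIntegral.integral_congr fun θ' h' => ?_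
      rw [hu2] at h
      rw [hu] at h'
      simp only [hMe θ' h', hMLe θ (sub2 θ h), hNe θ (sub2 θ h)]
  · refine intervalIntegral.integral_congr fun θ h => ?_
    rw [hu3] at h
    simp only [hMLe θ h, hNe θ h]
end
end
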